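/- Let S ⊂ ℂ^N be a local real-analytic subvariety. For every p ∈ S there exists a neighborhood U of p such that for every q ∈ U and every germ of a complex variety (V, q) ⊂ (S, q), there exists a closed complex subvariety W ⊂ U with (V, q) ⊂ (W, q) and W ⊂ S ∩ U. -/

import Mathlib

/- Common definitions: real-analytic and complex-analytic subvarieties of ℂ^N,
Levi-flat hypervarieties, CR submanifolds, Segre varieties, etc. -/

open Complex Set Topology Filter
open scoped ENNReal

noncomputable section

abbrev CN (N : ℕ) := Fin N → ℂ

/-- `X` is a (relatively closed) real-analytic subvariety of the open set `U ⊆ ℂ^N`. -/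
def IsRealSubvariety (N : ℕ) (U X : Set (CN N)) : Prop :=
  X ⊆ U ∧ closure X ∩ U ⊆ X ∧
    ∀ p ∈ U, ∃ V : Set (CN N), IsOpen V ∧ p ∈ V ∧ V ⊆ U ∧
      ∃ (k : ℕ) (f : Fin k → CN N → ℝ),
        (∀ i, AnalyticOn ℝ (f i) V) ∧ X ∩ V = {z ∈ V | ∀ i, f i z = 0}

/-- `X` is a (relatively closed) complex-analytic subvariety of the open set `U ⊆ ℂ^N`. -/
def IsComplexSubvariety (N : ℕ) (U X : Set (CN N)) : Prop :=
  X ⊆ U ∧ closure X ∩ U ⊆ X ∧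
    ∀ p ∈ U, ∃ V : Set (CN N), IsOpen V ∧ p ∈ V ∧ V ⊆ U ∧
      ∃ (k : ℕ) (f : Fin k → CN N → ℂ),
        (∀ i, AnalyticOn ℂ (f i) V) ∧ X ∩ V = {z ∈ V | ∀ i, f i z = 0}

/-- `X` is a real-analytic subvariety of the (not necessarily open) set `V`. -/
def IsRealSubvarietyIn (N : ℕ) (V X : Set (CN N)) : Prop :=
  X ⊆ V ∧ closure X ∩ V ⊆ X ∧
    ∀ p ∈ V, ∃ W : Set (CN N), IsOpen W ∧ p ∈ W ∧
      ∃ (k : ℕ) (f : Fin k → CN N → ℝ),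
        (∀ i, AnalyticOn ℝ (f i) W) ∧ X ∩ W = {z ∈ V ∩ W | ∀ i, f i z = 0}

/-- `X` is a complex-analytic subvariety of the (not necessarily open) set `V`. -/
def IsComplexSubvarietyIn (N : ℕ) (V X : Set (CN N)) : Prop :=
  X ⊆ V ∧ closure X ∩ V ⊆ X ∧
    ∀ p ∈ V, ∃ W : Set (CN N), IsOpen W ∧ p ∈ W ∧
      ∃ (k : ℕ) (f : Fin k → CN N → ℂ),
        (∀ i, AnalyticOn ℂ (f i) W) ∧ X ∩ W = {z ∈ V ∩ W | ∀ i, f i z = 0}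

/-- Near `p`, `X` is a real-analytic submanifold of ℂ^N of real dimension `d`,
cut out by `2N - d` real-analytic functions with linearly independent differentials. -/
def IsSubmanifoldAtDim (N d : ℕ) (X : Set (CN N)) (p : CN N) : Prop :=
  ∃ (V : Set (CN N)) (f : Fin (2 * N - d) → CN N → ℝ),
    IsOpen V ∧ p ∈ V ∧ (∀ i, AnalyticOn ℝ (f i) V) ∧
    (∀ z ∈ V, LinearIndependent ℝ fun i => fderiv ℝ (f i) z) ∧
    X ∩ V = {z ∈ V | ∀ i, f i z = 0}

/-- Near `p`, `X` is a complex submanifold of ℂ^N of complex dimension `d`. -/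
def IsCxSubmanifoldAtDim (N d : ℕ) (X : Set (CN N)) (p : CN N) : Prop :=
  ∃ (V : Set (CN N)) (f : Fin (N - d) → CN N → ℂ),
    IsOpen V ∧ p ∈ V ∧ (∀ i, AnalyticOn ℂ (f i) V) ∧
    (∀ z ∈ V, LinearIndependent ℂ fun i => fderiv ℂ (f i) z) ∧
    X ∩ V = {z ∈ V | ∀ i, f i z = 0}

/-- Points near which `X` is a real-analytic submanifold of some dimension. -/
def regPts (N : ℕ) (X : Set (CN N)) : Set (CN N) :=
  {p ∈ X | ∃ d, IsSubmanifoldAtDim N d X p}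

/-- The singular set `X_s` of a real-analytic subvariety. -/
def singSet (N : ℕ) (X : Set (CN N)) : Set (CN N) := X \ regPts N X

/-- `H*`: the points near which `H` is a nonsingular real-analytic hypersurface. -/
def hypStar (N : ℕ) (H : Set (CN N)) : Set (CN N) :=
  {p ∈ H | IsSubmanifoldAtDim N (2 * N - 1) H p}

/-- Near `p` the hypersurface `H` is given by `Im f = 0` for a holomorphic `f` with
nonvanishing differential (the local model of a nonsingular Levi-flat hypersurface). -/
def IsLeviFlatHypAt (N : ℕ) (H : Set (CN N)) (p : CN N) : Prop :=
  ∃ (V : Set (CN N)) (f : CN N → ℂ),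
    IsOpen V ∧ p ∈ V ∧ AnalyticOn ℂ f V ∧ (∀ z ∈ V, fderiv ℂ f z ≠ 0) ∧
    H ∩ V = {z ∈ V | (f z).im = 0}

/-- A Levi-flat real-hypervariety `H` of the open set `U`: a relatively closed
real-analytic subvariety of real dimension `2N - 1` whose regular hypersurface
part `H*` is Levi-flat. -/
def IsLeviFlatHypervariety (N : ℕ) (U H : Set (CN N)) : Prop :=
  IsOpen U ∧ IsRealSubvariety N U H ∧ dimH H = ((2 * N - 1 : ℕ) : ℝ≥0∞) ∧
    ∀ p ∈ hypStar N H, IsLeviFlatHypAt N H p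

/-- Near `p`, in suitable local holomorphic coordinates `Φ`, the set `M` is given by
`Im z₁ = ⋯ = Im z_j = 0`, `z_{j+1} = ⋯ = z_k = 0`: `M` is a Levi-flat CR
submanifold at `p`. -/
def IsLeviFlatCRAt (N : ℕ) (M : Set (CN N)) (p : CN N) : Prop :=
  ∃ (V : Set (CN N)) (Φ : CN N → CN N) (j k : ℕ),
    j ≤ k ∧ k ≤ N ∧ IsOpen V ∧ p ∈ V ∧
    AnalyticOn ℂ Φ V ∧ InjOn Φ V ∧
    (∀ z ∈ V, Function.Bijective ⇑(fderiv ℂ Φ z)) ∧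
    M ∩ V = {z ∈ V | (∀ i : Fin N, (i : ℕ) < j → (Φ z i).im = 0) ∧
      ∀ i : Fin N, j ≤ (i : ℕ) → (i : ℕ) < k → Φ z i = 0}

/-- The holomorphic part `∂r` of the differential of a real function `r` at `z`,
as a complex-valued form: `∂r(v) = dr(v) - i · dr(i·v)` (up to a factor `2`). -/
def delForm (N : ℕ) (r : CN N → ℝ) (z : CN N) : CN N → ℂ := fun v =>
  Complex.ofReal (fderiv ℝ r z v) -
    Complex.I * Complex.ofReal (fderiv ℝ r z (Complex.I • v))

/-- `M` is a generic submanifold near `p`: locally cut out by real-analytic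
`r₁, …, r_k` with `∂r₁, …, ∂r_k` linearly independent. -/
def IsGenericSubmanifoldAt (N : ℕ) (M : Set (CN N)) (p : CN N) : Prop :=
  ∃ (V : Set (CN N)) (k : ℕ) (r : Fin k → CN N → ℝ),
    IsOpen V ∧ p ∈ V ∧ (∀ i, AnalyticOn ℝ (r i) V) ∧
    (∀ z ∈ V, LinearIndependent ℝ fun i => fderiv ℝ (r i) z) ∧
    (∀ z ∈ V, LinearIndependent ℂ fun i => delForm N (r i) z) ∧
    M ∩ V = {z ∈ V | ∀ i, r i z = 0}

/-- Near `p`, in suitable local holomorphic coordinates, `M` is `{Im z₁ = Im z₂ = 0}`: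
the local model of a generic Levi-flat submanifold of real dimension `2N - 2`. -/
def IsGenericLeviFlat2At (N : ℕ) (M : Set (CN N)) (p : CN N) : Prop :=
  ∃ (V : Set (CN N)) (Φ : CN N → CN N),
    IsOpen V ∧ p ∈ V ∧ AnalyticOn ℂ Φ V ∧ InjOn Φ V ∧
    (∀ z ∈ V, Function.Bijective ⇑(fderiv ℂ Φ z)) ∧
    M ∩ V = {z ∈ V | ∀ i : Fin N, (i : ℕ) < 2 → (Φ z i).im = 0}

/-- The complex-tangent (CR) vectors to `M` at `p`. -/
def crTangent (N : ℕ) (M : Set (CN N)) (p : CN N) : Set (CN N) :=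
  {v | v ∈ tangentConeAt ℝ M p ∧ Complex.I • v ∈ tangentConeAt ℝ M p}

/-- The CR dimension of `M` at `p`. -/
def crDim (N : ℕ) (M : Set (CN N)) (p : CN N) : ℕ :=
  Module.finrank ℂ (Submodule.span ℂ (crTangent N M p))

/-- `M` is a real-analytic CR submanifold: a real-analytic submanifold with
constant CR dimension. -/
def IsCRSubmanifold (N : ℕ) (M : Set (CN N)) : Prop :=
  (∃ d, ∀ p ∈ M, IsSubmanifoldAtDim N d M p) ∧ ∃ m, ∀ p ∈ M, crDim N M p = m

/-- Coordinatewise complex conjugation. -/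
def conjPt (N : ℕ) (z : CN N) : CN N := fun i => starRingEnd ℂ (z i)

/-- `R` is the complexification `r(z, w̄)` of the real-analytic function `r` on `U`:
it is holomorphic on `U × *U` (where `*U` is the conjugate of `U`) and `R(z, z̄) = r(z)`. -/
def IsComplexification (N : ℕ) (U : Set (CN N)) (r : CN N → ℝ)
    (R : CN N → CN N → ℂ) : Prop :=
  AnalyticOn ℂ (fun zw : CN N × CN N => R zw.1 zw.2) (U ×ˢ (conjPt N '' U)) ∧
    ∀ z ∈ U, R z (conjPt N z) = Complex.ofReal (r z)

/-- The Segre variety `Σ_p(U, r) = {z ∈ U : r(z, p̄) = 0}`, for `R` the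
complexification of `r`. -/
def segreSet (N : ℕ) (U : Set (CN N)) (R : CN N → CN N → ℂ) (p : CN N) : Set (CN N) :=
  {z ∈ U | R z (conjPt N p) = 0}

/-- `p` is a Segre-degenerate singularity of `H`: for every local defining function `r` of
`H` at `p`, the function `z ↦ r(z, p̄)` vanishes identically near `p`. -/
def IsSegreDegenerateAt (N : ℕ) (H : Set (CN N)) (p : CN N) : Prop :=
  ∀ (V : Set (CN N)) (r : CN N → ℝ) (R : CN N → CN N → ℂ),
    IsOpen V → p ∈ V → AnalyticOn ℝ r V → IsComplexification N V r R →
    H ∩ V = {z ∈ V | r z = 0} → ∀ᶠ z in nhds p, R z (conjPt N p) = 0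

/-- `Σ'`: the union of all complex subvarieties of `V` of complex dimension `N - 1`
contained in `H`. -/
def sigmaPrime (N : ℕ) (H V : Set (CN N)) : Set (CN N) :=
  ⋃₀ {W | IsComplexSubvariety N V W ∧ W ⊆ H ∧ dimH W = ((2 * N - 2 : ℕ) : ℝ≥0∞)}

/-- `p` is a leaf-degenerate point of `H`: the germ `Σ'_p(H)` is not a complex variety of
dimension `N - 1`, i.e. there is no single complex subvariety `W ∋ p` of dimension `N - 1`
inside `H` containing all complex hypervarieties of `H` near `p`. -/
def IsLeafDegenerateAt (N : ℕ) (H : Set (CN N)) (p : CN N) : Prop :=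
  ¬∃ (V W : Set (CN N)), IsOpen V ∧ p ∈ V ∧ p ∈ W ∧ W ⊆ H ∧
    IsComplexSubvariety N V W ∧ dimH W = ((2 * N - 2 : ℕ) : ℝ≥0∞) ∧
    ∀ V' : Set (CN N), IsOpen V' → V' ⊆ V → sigmaPrime N H V' ⊆ W

/-- An irreducible complex subvariety of `U`. -/
def IsIrreducibleCxSubvariety (N : ℕ) (U W : Set (CN N)) : Prop :=
  IsComplexSubvariety N U W ∧ W.Nonempty ∧
    ∀ W₁ W₂ : Set (CN N), IsComplexSubvariety N U W₁ → IsComplexSubvariety N U W₂ →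
      W = W₁ ∪ W₂ → W = W₁ ∨ W = W₂

/-- The germ of the real-analytic variety `H` at `p` is irreducible: in any decomposition
of `H` near `p` into two real-analytic subvarieties, one of them contains `H` near `p`. -/
def IsIrreducibleGermAt (N : ℕ) (H : Set (CN N)) (p : CN N) : Prop :=
  ∀ V H₁ H₂ : Set (CN N), IsOpen V → p ∈ V →
    IsRealSubvariety N V H₁ → IsRealSubvariety N V H₂ → H ∩ V = H₁ ∪ H₂ →
    ∃ V' : Set (CN N), IsOpen V' ∧ p ∈ V' ∧ (H ∩ V' ⊆ H₁ ∨ H ∩ V' ⊆ H₂)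

/-- `M` is minimal at `p`: every (real-analytic) CR submanifold of `M` through `p` with
the same CR dimension contains a neighborhood of `p` in `M`. -/
def IsMinimalAt (N : ℕ) (M : Set (CN N)) (p : CN N) : Prop :=
  ∀ M' : Set (CN N), p ∈ M' → M' ⊆ M →
    (∃ d, ∀ q ∈ M', IsSubmanifoldAtDim N d M' q) →
    (∀ q ∈ M', crDim N M' q = crDim N M p) →
    ∃ V : Set (CN N), IsOpen V ∧ p ∈ V ∧ M ∩ V ⊆ M'

/-- `O` is (a representative of) the local CR orbit of `M` at `p`, of dimension `d`:
the smallest CR submanifold of `M` through `p` of the same CR dimension as `M` at `p`. -/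
def IsCROrbitAt (N d : ℕ) (M O : Set (CN N)) (p : CN N) : Prop :=
  p ∈ O ∧ O ⊆ M ∧ (∀ q ∈ O, IsSubmanifoldAtDim N d O q) ∧
    (∀ q ∈ O, crDim N O q = crDim N M p) ∧
    ∀ O' : Set (CN N), p ∈ O' → O' ⊆ M →
      (∃ d', ∀ q ∈ O', IsSubmanifoldAtDim N d' O' q) →
      (∀ q ∈ O', crDim N O' q = crDim N M p) →
      ∃ V : Set (CN N), IsOpen V ∧ p ∈ V ∧ O ∩ V ⊆ O'

/-- `r` generates the ideal of germs at `p` of real-analytic functions vanishing on `H`. -/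
def GeneratesVanishingIdealAt (N : ℕ) (H V : Set (CN N)) (r : CN N → ℝ) (p : CN N) :
    Prop :=
  (∀ z ∈ H ∩ V, r z = 0) ∧
    ∀ (V' : Set (CN N)) (g : CN N → ℝ), IsOpen V' → p ∈ V' → AnalyticOn ℝ g V' →
      (∀ z ∈ H ∩ V', g z = 0) →
      ∃ (V'' : Set (CN N)) (q : CN N → ℝ), IsOpen V'' ∧ p ∈ V'' ∧ V'' ⊆ V ∩ V' ∧
        AnalyticOn ℝ q V'' ∧ ∀ z ∈ V'', g z = q z * r z

/-- The exterior derivative of a one-form `ω`, evaluated at `z` on `(u, v)`. -/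
def oneFormD (N : ℕ) (ω : CN N → (CN N →L[ℂ] ℂ)) (z u v : CN N) : ℂ :=
  fderiv ℂ ω z u v - fderiv ℂ ω z v u

/-- `(ω ∧ dω)(u, v, w)` at `z`; its vanishing is complete integrability of `ω`. -/
def integrabilityWedge (N : ℕ) (ω : CN N → (CN N →L[ℂ] ℂ)) (z u v w : CN N) : ℂ :=
  ω z u * oneFormD N ω z v w - ω z v * oneFormD N ω z u w + ω z w * oneFormD N ω z u v

open MeasureTheory Metric

/-- A circle integral of a function depending in a `C¹` way on a complex parameter is `C¹` in the
parameter. -/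
theorem contDiffOn_circleIntegral {P : Type*} [NormedAddCommGroup P] [NormedSpace ℂ P]
    {U : Set P} (hU : IsOpen U) {O : Set (P × ℂ)} (hO : IsOpen O) {c : ℂ} {r : ℝ} (hr : 0 ≤ r)
    (hUO : U ×ˢ sphere c r ⊆ O) {G : P × ℂ → ℂ} (hG : ContDiffOn ℂ 1 G O) :
    ContDiffOn ℂ 1 (fun x => ∮ t in C(c, r), G (x, t)) U := by
  have hmem : ∀ x ∈ U, ∀ θ : ℝ, (x, circleMap c r θ) ∈ O := fun x hx θ =>
    hUO ⟨hx, circleMap_mem_sphere c hr θ⟩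
  have hGd : ∀ z ∈ O, HasFDerivAt G (fderiv ℂ G z) z := fun z hz =>
    ((hG.differentiableOn one_ne_zero).differentiableAt (hO.mem_nhds hz)).hasFDerivAt
  have hGc : ContinuousOn (fderiv ℂ G) O := hG.continuousOn_fderiv_of_isOpen hO le_rfl
  set K : P → ℝ → ℂ := fun x θ => deriv (circleMap c r) θ • G (x, circleMap c r θ) with hK
  set K' : P → ℝ → (P →L[ℂ] ℂ) := fun x θ => deriv (circleMap c r) θ •
    (fderiv ℂ G (x, circleMap c r θ)).comp (ContinuousLinearMap.inl ℂ P ℂ) with hK'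
  have hderivc : Continuous (fun θ : ℝ => deriv (circleMap c r) θ) := by
    simp only [deriv_circleMap]; fun_prop
  have hcm : Continuous (circleMap c r) := continuous_circleMap c r
  have hpair : ContinuousOn (fun z : P × ℝ => (z.1, circleMap c r z.2)) (U ×ˢ univ) := by
    fun_prop
  have hmaps : MapsTo (fun z : P × ℝ => (z.1, circleMap c r z.2)) (U ×ˢ univ) O :=
    fun z hz => hmem z.1 hz.1 z.2
  have hKc : ContinuousOn (fun z : P × ℝ => K z.1 z.2) (U ×ˢ univ) :=
    (hderivc.comp continuous_snd).continuousOn.smul (hG.continuousOn.comp hpair hmaps)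
  have hK'c : ContinuousOn (fun z : P × ℝ => K' z.1 z.2) (U ×ˢ univ) :=
    (hderivc.comp continuous_snd).continuousOn.smul
      ((hGc.comp hpair hmaps).clm_comp continuousOn_const)
  have hslice : ∀ x ∈ U, Continuous (K x) := fun x hx =>
    continuousOn_univ.1 <| hKc.comp (f := fun θ : ℝ => (x, θ)) (by fun_prop)
      (fun θ _ => ⟨hx, mem_univ _⟩)
  have hslice' : ∀ x ∈ U, Continuous (K' x) := fun x hx =>
    continuousOn_univ.1 <| hK'c.comp (f := fun θ : ℝ => (x, θ)) (by fun_prop)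
      (fun θ _ => ⟨hx, mem_univ _⟩)
  -- a uniform bound near each point
  have hbound : ∀ x₀ ∈ U, ∃ C : ℝ, ∀ᶠ x in 𝓝 x₀, ∀ θ ∈ uIcc 0 (2 * Real.pi), ‖K' x θ‖ ≤ C := by
    intro x₀ hx₀
    obtain ⟨C, hC⟩ :=
      (isCompact_uIcc (a := (0 : ℝ)) (b := 2 * Real.pi)).exists_bound_of_continuousOn
      (hslice' x₀ hx₀).continuousOn
    refine ⟨C + 1, isCompact_uIcc.eventually_forall_of_forall_eventually fun θ hθ => ?_⟩
    have hat : ContinuousAt (fun z : P × ℝ => K' z.1 z.2) (x₀, θ) :=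
      hK'c.continuousAt ((hU.prod isOpen_univ).mem_nhds ⟨hx₀, mem_univ _⟩)
    have : ∀ᶠ z in 𝓝 (x₀, θ), ‖K' z.1 z.2‖ < C + 1 :=
      hat.norm.eventually (gt_mem_nhds (by simpa using (hC θ hθ).trans_lt (lt_add_one C)))
    exact this.mono fun z hz => hz.le
  have hder : ∀ x₀ ∈ U, HasFDerivAt (fun x => ∮ t in C(c, r), G (x, t))
      (∫ θ in (0 : ℝ)..2 * Real.pi, K' x₀ θ) x₀ := by
    intro x₀ hx₀
    obtain ⟨C, hC⟩ := hbound x₀ hx₀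
    have hUn := hU.mem_nhds hx₀
    refine intervalIntegral.hasFDerivAt_integral_of_dominated_of_fderiv_le (F := K) (F' := K')
      (s := U ∩ {x | ∀ θ ∈ uIcc 0 (2 * Real.pi), ‖K' x θ‖ ≤ C}) (bound := fun _ => C)
      (inter_mem hUn hC) ?_ ((hslice x₀ hx₀).intervalIntegrable _ _)
      (hslice' x₀ hx₀).aestronglyMeasurable ?_ intervalIntegrable_const ?_
    · filter_upwards [hUn] with x hx using (hslice x hx).aestronglyMeasurable
    · exact Eventually.of_forall fun θ hθ x hx => hx.2 θ (uIoc_subset_uIcc hθ)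
    · refine Eventually.of_forall fun θ _ x hx => ?_
      have := (hGd _ (hmem x hx.1 θ)).comp (f := fun y => (y, circleMap c r θ)) x
        (hasFDerivAt_prodMk_left x _)
      exact this.const_smul (deriv (circleMap c r) θ)
  rw [show (1 : WithTop ℕ∞) = 0 + 1 from rfl, contDiffOn_succ_iff_fderiv_of_isOpen hU]
  refine ⟨fun x hx => (hder x hx).differentiableAt.differentiableWithinAt, by simp, ?_⟩
  rw [contDiffOn_zero]
  have hcont : ContinuousOn (fun x => ∫ θ in (0 : ℝ)..2 * Real.pi, K' x θ) U := by
    intro x₀ hx₀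
    obtain ⟨C, hC⟩ := hbound x₀ hx₀
    have hUn := hU.mem_nhds hx₀
    refine (intervalIntegral.continuousAt_of_dominated_interval (bound := fun _ => C) ?_ ?_
      intervalIntegrable_const ?_).continuousWithinAt
    · filter_upwards [hUn] with x hx using (hslice' x hx).aestronglyMeasurable
    · filter_upwards [hC] with x hx
      exact Eventually.of_forall fun θ hθ => hx θ (uIoc_subset_uIcc hθ)
    · refine Eventually.of_forall fun θ _ => ?_
      exact (hK'c.continuousAt ((hU.prod isOpen_univ).mem_nhds ⟨hx₀, mem_univ _⟩)).comp
        (f := fun x => (x, θ)) (by fun_prop)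
  exact hcont.congr fun x hx => (hder x hx).fderiv

/-- The derivative in the last variable of a `C¹` function of complex variables is again `C¹`. -/
theorem contDiffOn_deriv_snd {P : Type*} [NormedAddCommGroup P] [NormedSpace ℂ P]
    {U : Set P} (hU : IsOpen U) {c : ℂ} {R : ℝ} {F : P × ℂ → ℂ}
    (hF : ContDiffOn ℂ 1 F (U ×ˢ ball c R)) :
    ContDiffOn ℂ 1 (fun z : P × ℂ => deriv (fun t => F (z.1, t)) z.2) (U ×ˢ ball c R) := by
  have hslice : ∀ x ∈ U, DifferentiableOn ℂ (fun t => F (x, t)) (ball c R) := fun x hx =>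
    (hF.differentiableOn one_ne_zero).comp (f := fun t : ℂ => (x, t)) (by fun_prop)
      (fun t ht => ⟨hx, ht⟩)
  rintro ⟨x₁, t₁⟩ ⟨hx₁, ht₁⟩
  obtain ⟨R', hR', hR'R⟩ := exists_between (mem_ball.1 ht₁)
  have hR'0 : 0 < R' := dist_nonneg.trans_lt hR'
  have hOpen : IsOpen (U ×ˢ ball c R') := hU.prod isOpen_ball
  set O : Set ((P × ℂ) × ℂ) := ((U ×ˢ ball c R') ×ˢ ball c R) ∩ {z | z.2 - z.1.2 ≠ 0}
  have hO : IsOpen O := (hOpen.prod isOpen_ball).inter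
    (isOpen_ne_fun (by fun_prop) continuous_const)
  have key := contDiffOn_circleIntegral (G := fun z : (P × ℂ) × ℂ =>
    ((z.2 - z.1.2) ^ 2)⁻¹ * F (z.1.1, z.2)) hOpen hO (c := c) (r := R') hR'0.le ?_ ?_
  · have hmem : (x₁, t₁) ∈ U ×ˢ ball c R' := ⟨hx₁, hR'⟩
    refine ContDiffAt.contDiffWithinAt ?_
    refine ((contDiffOn_const (c := (2 * Real.pi * I : ℂ)⁻¹)).mul key).contDiffAt
      (hOpen.mem_nhds hmem) |>.congr_of_eventuallyEq ?_
    filter_upwards [hOpen.mem_nhds hmem] with z hz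
    have := two_pi_I_inv_smul_circleIntegral_sub_sq_inv_smul_of_differentiable
      (U := ball c R) isOpen_ball (closedBall_subset_ball hR'R) (hslice z.1 hz.1) hz.2
    simpa [smul_eq_mul] using this.symm
  · rintro ⟨⟨x, t⟩, τ⟩ ⟨⟨hx, ht⟩, hτ⟩
    refine ⟨⟨⟨hx, ht⟩, sphere_subset_closedBall.trans (closedBall_subset_ball hR'R) hτ⟩, ?_⟩
    simp only [Set.mem_ofPred_eq, ne_eq, sub_eq_zero]
    rintro rfl
    exact (mem_ball.1 ht).ne (mem_sphere.1 hτ)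
  · refine ContDiffOn.mul ?_ ?_
    · refine ContDiffOn.inv (by fun_prop) ?_
      intro z hz
      exact pow_ne_zero 2 hz.2
    · exact hF.comp (f := fun z : (P × ℂ) × ℂ => (z.1.1, z.2)) (by fun_prop)
        (fun z hz => ⟨hz.1.1.1, hz.1.2⟩)

/-- A holomorphic function on a disc without zeros on a smaller circle has finitely many zeros
inside that circle. -/
theorem finite_zeros_ball {f : ℂ → ℂ} {c : ℂ} {r R : ℝ} (hr : 0 < r) (hrR : r < R)
    (hf : DifferentiableOn ℂ f (ball c R)) (hs : ∀ t ∈ sphere c r, f t ≠ 0) :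
    {t ∈ ball c r | f t = 0}.Finite := by
  by_contra hinf
  obtain ⟨x, hx, hacc⟩ := Set.Infinite.exists_accPt_of_subset_isCompact hinf
    (isCompact_closedBall c r) (fun t ht => ball_subset_closedBall ht.1)
  have h0 := (hf.analyticOnNhd isOpen_ball).eqOn_zero_of_preconnected_of_frequently_eq_zero
    (convex_ball c R).isPreconnected (closedBall_subset_ball hrR hx)
    ((accPt_iff_frequently_nhdsNE.1 hacc).mono fun y hy => hy.2)
  have hmem : c + r ∈ sphere c r := by simp [abs_of_pos hr]
  exact hs _ hmem (h0 (closedBall_subset_ball hrR (sphere_subset_closedBall hmem)))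

/-- Residue theorem for logarithmic derivatives: the zeros of `f` inside a circle, counted with
multiplicity, compute the weighted integrals of the logarithmic derivative. -/
theorem exists_multiset_zeros {f : ℂ → ℂ} {c : ℂ} {r R : ℝ} (hr : 0 < r) (hrR : r < R)
    (hf : DifferentiableOn ℂ f (ball c R)) (hs : ∀ t ∈ sphere c r, f t ≠ 0) :
    ∃ A : Multiset ℂ, (∀ t, t ∈ A ↔ t ∈ ball c r ∧ f t = 0) ∧
      ∀ h : ℂ → ℂ, DifferentiableOn ℂ h (ball c R) →
        ∮ t in C(c, r), h t * (deriv f t / f t) = 2 * Real.pi * I * (A.map h).sum := by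
  have hsub : closedBall c r ⊆ ball c R := closedBall_subset_ball hrR
  have hssub : sphere c r ⊆ ball c R := sphere_subset_closedBall.trans hsub
  induction hn : {t ∈ ball c r | f t = 0}.ncard using Nat.strong_induction_on generalizing f with
  | _ n ih =>
  rcases Set.eq_empty_or_nonempty {t ∈ ball c r | f t = 0} with he | ⟨a, ha, ha0⟩
  · refine ⟨0, fun t => ?_, fun h hh => ?_⟩
    · have : t ∉ {t ∈ ball c r | f t = 0} := by rw [he]; exact notMem_empty t
      simpa using this
    · have hne : ∀ t ∈ closedBall c r, f t ≠ 0 := by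
        intro t ht h0
        rcases (mem_closedBall.1 ht).lt_or_eq with h1 | h1
        · exact he.subset (⟨h1, h0⟩ : t ∈ {t ∈ ball c r | f t = 0})
        · exact hs t h1 h0
      simp only [Multiset.map_zero, Multiset.sum_zero, mul_zero]
      refine DiffContOnCl.circleIntegral_eq_zero hr.le (DifferentiableOn.diffContOnCl_ball
        (U := closedBall c r) ?_ subset_rfl)
      exact (hh.mono hsub).mul (((hf.deriv isOpen_ball).mono hsub).div (hf.mono hsub) hne)
  · have haR : a ∈ ball c R := hsub (ball_subset_closedBall ha)
    have hfa := hf.analyticOnNhd isOpen_ball a haR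
    have htop : analyticOrderAt f a ≠ ⊤ := by
      intro h
      have h0 := (hf.analyticOnNhd isOpen_ball).eqOn_zero_of_preconnected_of_eventuallyEq_zero
        (convex_ball c R).isPreconnected haR (analyticOrderAt_eq_top.1 h)
      have hmem : c + r ∈ sphere c r := by simp [abs_of_pos hr]
      exact hs _ hmem (h0 (hssub hmem))
    obtain ⟨k, hk⟩ := ENat.ne_top_iff_exists.1 htop
    obtain ⟨g, hg, hga, hfg⟩ := hfa.analyticOrderAt_eq_natCast.1 hk.symm
    have hk0 : k ≠ 0 := by
      rintro rfl
      have := hfg.self_of_nhds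
      rw [ha0] at this
      simp only [pow_zero, one_smul] at this
      exact hga this.symm
    set G : ℂ → ℂ := Function.update (fun t => f t / (t - a) ^ k) a (g a) with hG
    have hGa : G a = g a := Function.update_self ..
    have hGne : ∀ t, t ≠ a → G t = f t / (t - a) ^ k := fun t ht => Function.update_of_ne ht ..
    have hfG : ∀ t, f t = (t - a) ^ k * G t := by
      intro t
      rcases eq_or_ne t a with rfl | ht
      · simp [ha0, hk0]
      · rw [hGne t ht, mul_div_cancel₀ _ (pow_ne_zero k (sub_ne_zero.2 ht))]
    have hGd : DifferentiableOn ℂ G (ball c R) := by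
      intro t ht
      refine DifferentiableAt.differentiableWithinAt ?_
      rcases eq_or_ne t a with rfl | hta
      · refine hg.differentiableAt.congr_of_eventuallyEq ?_
        filter_upwards [hfg] with z hz
        rcases eq_or_ne z t with rfl | hzt
        · exact hGa
        · rw [hGne z hzt, hz, smul_eq_mul,
            mul_div_cancel_left₀ _ (pow_ne_zero k (sub_ne_zero.2 hzt))]
      · have h1 : DifferentiableAt ℂ (fun t => f t / (t - a) ^ k) t :=
          (hf.differentiableAt (isOpen_ball.mem_nhds ht)).div (by fun_prop)
            (pow_ne_zero k (sub_ne_zero.2 hta))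
        refine h1.congr_of_eventuallyEq ?_
        filter_upwards [isOpen_ne.mem_nhds hta] with z hz using hGne z hz
    have hsa : ∀ t ∈ sphere c r, t ≠ a := by
      rintro t ht rfl
      exact (mem_ball.1 ha).ne ht
    have hGs : ∀ t ∈ sphere c r, G t ≠ 0 := by
      intro t ht h0
      exact hs t ht (by rw [hfG, h0, mul_zero])
    have hzeros : ∀ t, f t = 0 ↔ t = a ∨ G t = 0 := by
      intro t
      rw [hfG, mul_eq_zero, pow_eq_zero_iff hk0, sub_eq_zero]
    have hlt : {t ∈ ball c r | G t = 0}.ncard < n := by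
      rw [← hn]
      refine Set.ncard_lt_ncard ⟨fun t ht => ⟨ht.1, (hzeros t).2 (Or.inr ht.2)⟩, fun h => ?_⟩
        (finite_zeros_ball hr hrR hf hs)
      exact hga (hGa ▸ (h ⟨ha, ha0⟩).2)
    obtain ⟨A, hA, hAi⟩ := ih _ hlt hGd hGs rfl
    refine ⟨Multiset.replicate k a + A, fun t => ?_, fun h hh => ?_⟩
    · rw [Multiset.mem_add, hA, Multiset.mem_replicate, hzeros]
      constructor
      · rintro (⟨-, rfl⟩ | h)
        · exact ⟨ha, Or.inl rfl⟩
        · exact ⟨h.1, Or.inr h.2⟩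
      · rintro ⟨h1, rfl | h2⟩
        · exact Or.inl ⟨hk0, rfl⟩
        · exact Or.inr ⟨h1, h2⟩
    · have hGat : ∀ t ∈ sphere c r, DifferentiableAt ℂ G t := fun t ht =>
        hGd.differentiableAt (isOpen_ball.mem_nhds (hssub ht))
      have hld : EqOn (fun t => h t * (deriv f t / f t))
          (fun t => (t - a)⁻¹ • (k * h t) + h t * (deriv G t / G t)) (sphere c r) := by
        intro t ht
        have h1 := sub_ne_zero.2 (hsa t ht)
        have hfun : f = fun t => (t - a) ^ k * G t := funext hfG
        have h2 : deriv f t / f t = k / (t - a) + deriv G t / G t := by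
          have := logDeriv_mul (f := fun t => (t - a) ^ k) (g := G) t (pow_ne_zero k h1) (hGs t ht)
            (by fun_prop) (hGat t ht)
          rw [← hfun] at this
          rw [← logDeriv_apply, this, logDeriv_apply G, logDeriv_fun_pow (by fun_prop)]
          simp [logDeriv_apply, div_eq_mul_inv]
        simp only [h2, smul_eq_mul]
        ring
      rw [circleIntegral.integral_congr hr.le hld, circleIntegral.integral_add, hAi h hh,
        DifferentiableOn.circleIntegral_sub_inv_smul (f := fun t => k * h t)
          ((differentiableOn_const _).mul (hh.mono hsub)) ha]
      · simp [Multiset.sum_replicate]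
        ring
      · refine ContinuousOn.circleIntegrable hr.le (ContinuousOn.smul
          (ContinuousOn.inv₀ (by fun_prop) fun t ht => sub_ne_zero.2 (hsa t ht))
          (continuousOn_const.mul (hh.continuousOn.mono hssub)))
      · exact ContinuousOn.circleIntegrable hr.le ((hh.continuousOn.mono hssub).mul
          (((hGd.deriv isOpen_ball).continuousOn.mono hssub).div
            (hGd.continuousOn.mono hssub) hGs))

/-- The zeros in a disc of a holomorphic function depending holomorphically on a parameter form a
family of multisets of constant cardinality, and weighted sums over them are holomorphic. -/
theorem exists_parametric_zeros {P : Type*} [NormedAddCommGroup P] [NormedSpace ℂ P]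
    {D : Set P} (hD : IsOpen D) {x₀ : P} (hx₀ : x₀ ∈ D) {c : ℂ} {r R : ℝ} (hr : 0 < r)
    (hrR : r < R) {F : P × ℂ → ℂ} (hF : ContDiffOn ℂ 1 F (D ×ˢ ball c R))
    (hs : ∀ t ∈ sphere c r, F (x₀, t) ≠ 0) :
    ∃ D' ⊆ D, IsOpen D' ∧ x₀ ∈ D' ∧ ∃ (m : ℕ) (A : P → Multiset ℂ),
      (∀ x ∈ D', ∀ t ∈ sphere c r, F (x, t) ≠ 0) ∧
      (∀ x ∈ D', (A x).card = m) ∧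
      (∀ x ∈ D', ∀ t, t ∈ A x ↔ t ∈ ball c r ∧ F (x, t) = 0) ∧
      ∀ D'' ⊆ D', IsOpen D'' → ∀ g : P × ℂ → ℂ, ContDiffOn ℂ 1 g (D'' ×ˢ ball c R) →
        ContDiffOn ℂ 1 (fun x => ((A x).map fun t => g (x, t)).sum) D'' := by
  have hssub : sphere c r ⊆ ball c R := sphere_subset_closedBall.trans (closedBall_subset_ball hrR)
  have hslice : ∀ x ∈ D, ∀ D'' : Set P, x ∈ D'' → ∀ g : P × ℂ → ℂ,
      ContDiffOn ℂ 1 g (D'' ×ˢ ball c R) →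
      DifferentiableOn ℂ (fun t => g (x, t)) (ball c R) := fun x _ D'' hx g hg =>
    (hg.differentiableOn one_ne_zero).comp (f := fun t : ℂ => (x, t)) (by fun_prop)
      (fun t ht => ⟨hx, ht⟩)
  have hnear : ∀ᶠ x in 𝓝 x₀, x ∈ D ∧ ∀ t ∈ sphere c r, F (x, t) ≠ 0 := by
    refine (hD.eventually_mem hx₀).and
      ((isCompact_sphere c r).eventually_forall_of_forall_eventually
      fun t ht => ?_)
    exact (hF.continuousOn.continuousAt ((hD.prod isOpen_ball).mem_nhds
      ⟨hx₀, hssub ht⟩)).eventually_ne (hs t ht)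
  obtain ⟨D₁, hD₁, hD₁o, hx₁⟩ := _root_.eventually_nhds_iff.1 hnear
  have hex : ∀ x, ∃ A : Multiset ℂ, x ∈ D₁ → (∀ t, t ∈ A ↔ t ∈ ball c r ∧ F (x, t) = 0) ∧
      ∀ h : ℂ → ℂ, DifferentiableOn ℂ h (ball c R) →
        ∮ t in C(c, r), h t * (deriv (fun t => F (x, t)) t / F (x, t)) =
          2 * Real.pi * I * (A.map h).sum := by
    intro x
    by_cases hx : x ∈ D₁
    · obtain ⟨A, hA⟩ := exists_multiset_zeros hr hrR
        (hslice x (hD₁ x hx).1 D (hD₁ x hx).1 F hF) (hD₁ x hx).2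
      exact ⟨A, fun _ => hA⟩
    · exact ⟨0, fun h => absurd h hx⟩
  choose A hA using hex
  have hsum : ∀ D'' ⊆ D₁, IsOpen D'' → ∀ g : P × ℂ → ℂ, ContDiffOn ℂ 1 g (D'' ×ˢ ball c R) →
        ContDiffOn ℂ 1 (fun x => ((A x).map fun t => g (x, t)).sum) D'' := by
    intro D'' hsub hD'' g hg
    have hFD : ContDiffOn ℂ 1 F (D'' ×ˢ ball c R) :=
      hF.mono (prod_mono_left fun x hx => (hD₁ x (hsub hx)).1)
    have hO : IsOpen ((D'' ×ˢ ball c R) ∩ F ⁻¹' {0}ᶜ) :=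
      hFD.continuousOn.isOpen_inter_preimage (hD''.prod isOpen_ball) isOpen_compl_singleton
    have key := contDiffOn_circleIntegral (G := fun z : P × ℂ =>
      g z * (deriv (fun t => F (z.1, t)) z.2 / F z)) hD'' hO (c := c) (r := r) hr.le
      (fun z hz => ⟨⟨hz.1, hssub hz.2⟩, (hD₁ z.1 (hsub hz.1)).2 z.2 hz.2⟩)
      ((hg.mono inter_subset_left).mul (((contDiffOn_deriv_snd hD'' hFD).mono
        inter_subset_left).div (hFD.mono inter_subset_left) fun z hz => hz.2))
    refine ((contDiffOn_const (c := (2 * Real.pi * I : ℂ)⁻¹)).mul key).congr fun x hx => ?_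
    rw [(hA x (hsub hx)).2 (fun t => g (x, t)) (hslice x (hD₁ x (hsub hx)).1 D'' hx g hg),
      inv_mul_cancel_left₀ two_pi_I_ne_zero]
  have hcard : ∀ᶠ x in 𝓝 x₀, (A x).card = (A x₀).card := by
    have h1 := (hsum D₁ subset_rfl hD₁o (fun _ => 1) contDiffOn_const).continuousOn.continuousAt
      (hD₁o.mem_nhds hx₁)
    simp only [Multiset.map_const', Multiset.sum_replicate, nsmul_eq_mul, mul_one] at h1
    have h2 := Metric.continuousAt_iff'.1 h1 1 one_pos
    filter_upwards [h2] with x hx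
    rw [dist_eq_norm, ← Int.cast_natCast, ← Int.cast_natCast (Multiset.card (A x₀)),
      ← Int.cast_sub, Complex.norm_intCast, ← Int.cast_abs, ← Int.cast_one, Int.cast_lt,
      Int.abs_lt_one_iff] at hx
    omega
  obtain ⟨D₂, hD₂, hD₂o, hx₂⟩ := _root_.eventually_nhds_iff.1 hcard
  refine ⟨D₁ ∩ D₂, fun x hx => (hD₁ x hx.1).1, hD₁o.inter hD₂o, ⟨hx₁, hx₂⟩, (A x₀).card, A,
    fun x hx => (hD₁ x hx.1).2, fun x hx => hD₂ x hx.2, fun x hx => (hA x hx.1).1,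
    fun D'' hsub => hsum D'' (hsub.trans inter_subset_left)⟩

/-- The Hankel determinant of size `k` of the power sums of a multiset of complex numbers. -/
def hankelDet (A : Multiset ℂ) (k : ℕ) : ℂ :=
  Matrix.det (Matrix.of fun i j : Fin k => (A.map fun a => a ^ (i + j : ℕ)).sum)

theorem exists_hankel_factorization (A : Multiset ℂ) :
    ∃ (v c : Fin A.toFinset.card → ℂ), Function.Injective v ∧ (∀ l, c l ≠ 0) ∧ ∀ k : ℕ,
      Matrix.of (fun i j : Fin k => (A.map fun a => a ^ (i + j : ℕ)).sum) =
        (Matrix.of fun l (j : Fin k) => v l ^ (j : ℕ)).transpose *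
          (Matrix.diagonal c * Matrix.of fun l (j : Fin k) => v l ^ (j : ℕ)) := by
  classical
  set e := A.toFinset.equivFin.symm
  refine ⟨fun l => e l, fun l => A.count (e l : ℂ), Subtype.val_injective.comp e.injective,
    fun l => ?_, fun k => ?_⟩
  · exact Nat.cast_ne_zero.2 (Multiset.count_ne_zero.2 (Multiset.mem_toFinset.1 (e l).2))
  · ext i j
    rw [Matrix.mul_apply]
    simp only [Matrix.of_apply, Matrix.transpose_apply, Matrix.diagonal_mul]
    rw [Finset.sum_multiset_map_count, ← Finset.sum_coe_sort, ← e.sum_comp]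
    refine Finset.sum_congr rfl fun l _ => ?_
    rw [nsmul_eq_mul, pow_add]
    ring

theorem hankelDet_ne_zero (A : Multiset ℂ) : hankelDet A A.toFinset.card ≠ 0 := by
  obtain ⟨v, c, hv, hc, h⟩ := exists_hankel_factorization A
  rw [hankelDet, h, Matrix.det_mul, Matrix.det_mul, Matrix.det_transpose, Matrix.det_diagonal]
  have hV : (Matrix.of fun l (j : Fin A.toFinset.card) => v l ^ (j : ℕ)).det ≠ 0 :=
    Matrix.det_vandermonde_ne_zero_iff.2 hv
  exact mul_ne_zero hV (mul_ne_zero (Finset.prod_ne_zero_iff.2 fun l _ => hc l) hV)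

theorem hankelDet_eq_zero {A : Multiset ℂ} {k : ℕ} (hk : A.toFinset.card < k) :
    hankelDet A k = 0 := by
  obtain ⟨v, c, hv, hc, h⟩ := exists_hankel_factorization A
  rw [hankelDet, h, ← Matrix.exists_mulVec_eq_zero_iff]
  obtain ⟨w, hw, hw0⟩ := (Submodule.ne_bot_iff _).1 (LinearMap.ker_ne_bot_of_finrank_lt
    (f := (Matrix.of fun l (j : Fin k) => v l ^ (j : ℕ)).mulVecLin) (by simpa using hk))
  refine ⟨w, hw0, ?_⟩
  rw [LinearMap.mem_ker, Matrix.mulVecLin_apply] at hw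
  rw [← Matrix.mulVec_mulVec, ← Matrix.mulVec_mulVec, hw]
  simp

/-- The nonvanishing Hankel determinants bound the number of distinct elements. -/
theorem card_toFinset_le_of_hankelDet {A B : Multiset ℂ}
    (h : ∀ k ≤ A.card, hankelDet A k ≠ 0 → hankelDet B k ≠ 0) :
    A.toFinset.card ≤ B.toFinset.card := by
  by_contra hlt
  exact h _ (Multiset.toFinset_card_le A) (hankelDet_ne_zero A) (hankelDet_eq_zero (not_le.1 hlt))

/-- Zeros of a holomorphic function persist under holomorphic perturbation. -/
theorem eventually_exists_zero_mem_ball {P : Type*} [NormedAddCommGroup P] [NormedSpace ℂ P]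
    {D : Set (P × ℂ)} {x : P} {a : ℂ} (hD : D ∈ 𝓝 (x, a)) {f : P × ℂ → ℂ}
    (hf : ContDiffOn ℂ 1 f D) (h0 : f (x, a) = 0) (hiso : ∀ᶠ t in 𝓝[≠] a, f (x, t) ≠ 0)
    {ε : ℝ} (hε : 0 < ε) : ∀ᶠ y in 𝓝 x, ∃ t ∈ ball a ε, f (y, t) = 0 := by
  obtain ⟨U, hU, W, hW, hUW⟩ := mem_nhds_prod_iff.1 hD
  obtain ⟨U', hU', hU'o, hxU'⟩ := _root_.mem_nhds_iff.1 hU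
  obtain ⟨δ, hδ, hδW⟩ := Metric.mem_nhds_iff.1 hW
  obtain ⟨δ', hδ', hδ'i⟩ := Metric.mem_nhds_iff.1 (eventually_nhdsWithin_iff.1 hiso)
  obtain ⟨r, hr, hrlt⟩ := exists_between (lt_min (lt_min hδ hδ') hε)
  simp only [lt_min_iff] at hrlt
  obtain ⟨⟨hrδ, hrδ'⟩, hrε⟩ := hrlt
  obtain ⟨D', -, hD'o, hxD', m, A, -, hcard, hA, -⟩ := exists_parametric_zeros hU'o hxU' hr hrδ
    (hf.mono fun z hz => hUW ⟨hU' hz.1, hδW hz.2⟩) (fun t ht => by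
      refine hδ'i (a := t) (mem_ball.2 ((mem_sphere.1 ht).trans_lt hrδ')) ?_
      rintro rfl
      simp [hr.ne] at ht)
  have hm : 0 < m := by
    rw [← hcard x hxD', Multiset.card_pos_iff_exists_mem]
    exact ⟨a, (hA x hxD' a).2 ⟨mem_ball_self hr, h0⟩⟩
  filter_upwards [hD'o.mem_nhds hxD'] with y hy
  rw [← hcard y hy, Multiset.card_pos_iff_exists_mem] at hm
  obtain ⟨t, ht⟩ := hm
  have := (hA y hy t).1 ht
  exact ⟨t, ball_subset_ball hrε.le this.1, this.2⟩

/-- Where the number of distinct zeros is constant, the zeros are locally given by finitely many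
holomorphic functions of the parameter. -/
theorem exists_local_sections {P : Type*} [NormedAddCommGroup P] [NormedSpace ℂ P]
    {D : Set P} (hD : IsOpen D) {c : ℂ} {r R : ℝ} (hrR : r ≤ R) {F : P × ℂ → ℂ}
    (hF : ContDiffOn ℂ 1 F (D ×ˢ ball c R)) {Z : P → Finset ℂ}
    (hZ : ∀ x ∈ D, ∀ t, t ∈ Z x ↔ t ∈ ball c r ∧ F (x, t) = 0) {x₁ : P} (hx₁ : x₁ ∈ D) :
    ∃ N ⊆ D, IsOpen N ∧ x₁ ∈ N ∧ ∃ ρ > 0, ∃ σ : ℂ → P → ℂ,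
      (∀ a ∈ Z x₁, ContDiffOn ℂ 1 (σ a) N ∧ σ a x₁ = a) ∧
      ∀ x ∈ N, (Z x).card = (Z x₁).card →
        (∀ a ∈ Z x₁, σ a x ∈ Z x ∧ ∀ t ∈ Z x, t ∈ ball a ρ → t = σ a x) ∧
        ∀ t ∈ Z x, ∃ a ∈ Z x₁, t = σ a x := by
  classical
  have hρ : ∀ᶠ ρ : ℝ in 𝓝[>] 0, 0 < ρ ∧ ∀ a ∈ Z x₁, 2 * ρ < r - dist a c ∧
      ∀ b ∈ Z x₁, a ≠ b → 2 * ρ < dist a b := by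
    refine Eventually.and self_mem_nhdsWithin ((Finset.eventually_all _).2 fun a ha => ?_)
    have hlt : ∀ e : ℝ, 0 < e → ∀ᶠ ρ : ℝ in 𝓝[>] 0, 2 * ρ < e := fun e he => by
      have : Tendsto (fun ρ : ℝ => 2 * ρ) (𝓝 0) (𝓝 0) := by
        simpa using (continuous_const_mul (2 : ℝ)).tendsto 0
      exact (this.mono_left nhdsWithin_le_nhds).eventually (gt_mem_nhds he)
    refine (hlt _ (sub_pos.2 ((hZ x₁ hx₁ a).1 ha).1)).and
      ((Finset.eventually_all _).2 fun b hb => ?_)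
    by_cases hab : a = b
    · simp [hab]
    · simpa [hab] using hlt _ (dist_pos.2 hab)
  obtain ⟨ρ, hρ0, hρ⟩ := hρ.exists
  have hsubr : ∀ a ∈ Z x₁, ball a (2 * ρ) ⊆ ball c r := fun a ha =>
    ball_subset_ball' (by linarith [(hρ a ha).1])
  have hloc : ∀ a, ∃ (N : Set P) (m : ℕ) (A : P → Multiset ℂ), a ∈ Z x₁ →
      N ⊆ D ∧ IsOpen N ∧ x₁ ∈ N ∧ 0 < m ∧ (∀ x ∈ N, (A x).card = m) ∧
      (∀ x ∈ N, ∀ t, t ∈ A x ↔ t ∈ ball a ρ ∧ F (x, t) = 0) ∧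
      ContDiffOn ℂ 1 (fun x => (A x).sum) N := by
    intro a
    by_cases ha : a ∈ Z x₁
    · obtain ⟨N, hND, hN, hxN, m, A, -, hcard, hA, hsum⟩ := exists_parametric_zeros hD hx₁
        hρ0 (by linarith : ρ < 2 * ρ)
        (hF.mono (prod_mono_right ((hsubr a ha).trans (ball_subset_ball hrR)))) (by
        intro t ht h0
        have htb : t ∈ ball a (2 * ρ) := by
          rw [mem_ball, mem_sphere.1 ht]; linarith
        have htZ := (hZ x₁ hx₁ t).2 ⟨hsubr a ha htb, h0⟩
        have hne : t ≠ a := by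
          rintro rfl
          simp [hρ0.ne] at ht
        have := (hρ t htZ).2 a ha hne
        rw [mem_sphere.1 ht] at this
        linarith)
      refine ⟨N, m, A, fun _ => ⟨hND, hN, hxN, ?_, hcard, hA, ?_⟩⟩
      · rw [← hcard x₁ hxN, Multiset.card_pos_iff_exists_mem]
        exact ⟨a, (hA x₁ hxN a).2 ⟨mem_ball_self hρ0, ((hZ x₁ hx₁ a).1 ha).2⟩⟩
      · simpa using hsum N subset_rfl hN (fun z => z.2) (by fun_prop)
    · exact ⟨∅, 0, 0, fun h => absurd h ha⟩
  choose N m A hN using hloc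
  have hinball : ∀ a ∈ Z x₁, ball a ρ ⊆ ball c r := fun a ha =>
    (ball_subset_ball (by linarith)).trans (hsubr a ha)
  have hmemZ : ∀ a ∈ Z x₁, ∀ x ∈ N a, ∀ t ∈ A a x, t ∈ Z x ∧ t ∈ ball a ρ := by
    intro a ha x hx t ht
    obtain ⟨h1, -, -, -, -, h2, -⟩ := hN a ha
    have := (h2 x hx t).1 ht
    exact ⟨(hZ x (h1 hx) t).2 ⟨hinball a ha this.1, this.2⟩, this.1⟩
  have hsingle : ∀ a ∈ Z x₁, ∀ x ∈ N a, ∀ b, (∀ t ∈ A a x, t = b) →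
      (m a : ℂ)⁻¹ * (A a x).sum = b := by
    intro a ha x hx b hb
    obtain ⟨-, -, -, hm, hc, -, -⟩ := hN a ha
    rw [Multiset.eq_replicate.2 ⟨hc x hx, hb⟩, Multiset.sum_replicate, nsmul_eq_mul,
      inv_mul_cancel_left₀ (Nat.cast_ne_zero.2 hm.ne')]
  have hsep : ∀ a ∈ Z x₁, ∀ b ∈ Z x₁, ∀ t, t ∈ ball a ρ → t ∈ ball b ρ → a = b := by
    intro a ha b hb t hta htb
    by_contra hab
    have h1 := (hρ a ha).2 b hb hab
    have h2 := dist_triangle_left a b t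
    rw [mem_ball] at hta htb
    linarith
  refine ⟨D ∩ ⋂ a ∈ Z x₁, N a, inter_subset_left,
    hD.inter (isOpen_biInter_finset fun a ha => (hN a ha).2.1),
    ⟨hx₁, mem_iInter₂.2 fun a ha => (hN a ha).2.2.1⟩, ρ, hρ0,
    fun a x => (m a : ℂ)⁻¹ * (A a x).sum, fun a ha => ⟨?_, ?_⟩, ?_⟩
  · exact contDiffOn_const.mul ((hN a ha).2.2.2.2.2.2.mono
      (inter_subset_right.trans (biInter_subset_of_mem ha)))
  · refine hsingle a ha x₁ (hN a ha).2.2.1 a fun t ht => ?_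
    obtain ⟨h1, h2⟩ := hmemZ a ha x₁ (hN a ha).2.2.1 t ht
    exact hsep t h1 a ha t (mem_ball_self hρ0) h2
  · rintro x ⟨hxD, hxN⟩ hcard
    rw [mem_iInter₂] at hxN
    have hex : ∀ a, ∃ b, a ∈ Z x₁ → b ∈ A a x := by
      intro a
      by_cases ha : a ∈ Z x₁
      · obtain ⟨-, -, -, hm, hc, -, -⟩ := hN a ha
        rw [← hc x (hxN a ha), Multiset.card_pos_iff_exists_mem] at hm
        exact hm.imp fun b hb _ => hb
      · exact ⟨0, fun h => absurd h ha⟩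
    choose b hb using hex
    have hbZ : ∀ a ∈ Z x₁, b a ∈ Z x ∧ b a ∈ ball a ρ := fun a ha =>
      hmemZ a ha x (hxN a ha) _ (hb a ha)
    have himg : (Z x₁).image b = Z x := by
      refine Finset.eq_of_subset_of_card_le (Finset.image_subset_iff.2 fun a ha => (hbZ a ha).1) ?_
      rw [hcard, Finset.card_image_of_injOn]
      intro a ha a' ha' h
      exact hsep a ha a' ha' (b a) (hbZ a ha).2 (by rw [h]; exact (hbZ a' ha').2)
    have huniq : ∀ a ∈ Z x₁, ∀ t ∈ Z x, t ∈ ball a ρ → t = b a := by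
      intro a ha t ht hta
      rw [← himg, Finset.mem_image] at ht
      obtain ⟨a', ha', rfl⟩ := ht
      rw [hsep a ha a' ha' _ hta (hbZ a' ha').2]
    have hσ : ∀ a ∈ Z x₁, (m a : ℂ)⁻¹ * (A a x).sum = b a := fun a ha =>
      hsingle a ha x (hxN a ha) _ fun t ht =>
        huniq a ha t (hmemZ a ha x (hxN a ha) t ht).1 (hmemZ a ha x (hxN a ha) t ht).2
    refine ⟨fun a ha => ⟨?_, fun t ht hta => ?_⟩, fun t ht => ?_⟩
    · simpa only [hσ a ha] using (hbZ a ha).1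
    · simpa only [hσ a ha] using huniq a ha t ht hta
    · rw [← himg, Finset.mem_image] at ht
      obtain ⟨a, ha, rfl⟩ := ht
      exact ⟨a, ha, (hσ a ha).symm⟩

/-- The points `y` and `z` lie on a holomorphic disc contained in `A`. -/
def DiscJoinedIn {E : Type*} [NormedAddCommGroup E] [NormedSpace ℂ E] (A : Set E) (y z : E) :
    Prop :=
  ∃ (φ : ℂ → E) (Q : Set ℂ), IsOpen Q ∧ Convex ℝ Q ∧ 0 ∈ Q ∧ 1 ∈ Q ∧ DifferentiableOn ℂ φ Q ∧
    MapsTo φ Q A ∧ φ 0 = y ∧ φ 1 = z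

/-- A connected set which is locally connected by holomorphic discs. -/
def IsDiscConnected {E : Type*} [NormedAddCommGroup E] [NormedSpace ℂ E] (M : Set E) : Prop :=
  IsPreconnected M ∧ ∀ x ∈ M, ∀ O ∈ 𝓝 x, ∃ V ∈ 𝓝 x, ∀ y ∈ M ∩ V, ∀ y' ∈ M ∩ V,
    DiscJoinedIn (M ∩ O) y y'

section

variable {E E' : Type*} [NormedAddCommGroup E] [NormedSpace ℂ E] [NormedAddCommGroup E']
  [NormedSpace ℂ E']

theorem DiscJoinedIn.mono {A B : Set E} (h : A ⊆ B) {y y' : E} (hy : DiscJoinedIn A y y') :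
    DiscJoinedIn B y y' := by
  obtain ⟨φ, Q, h1, h2, h3, h4, h5, h6, h7⟩ := hy
  exact ⟨φ, Q, h1, h2, h3, h4, h5, h6.mono_right h, h7⟩

theorem DiscJoinedIn.map {A : Set E} {B : Set E'} {y y' : E} (hy : DiscJoinedIn A y y')
    {g : E → E'} {N : Set E} (hg : DifferentiableOn ℂ g N) (hAN : A ⊆ N) (hAB : MapsTo g A B) :
    DiscJoinedIn B (g y) (g y') := by
  obtain ⟨φ, Q, h1, h2, h3, h4, h5, h6, h7, h8⟩ := hy
  exact ⟨g ∘ φ, Q, h1, h2, h3, h4, hg.comp h5 (h6.mono_right hAN), hAB.comp h6, by simp [h7],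
    by simp [h8]⟩

/-- A disc yields a preconnected subset joining its points. -/
theorem DiscJoinedIn.exists_isPreconnected {A : Set E} {y y' : E} (hy : DiscJoinedIn A y y') :
    ∃ T ⊆ A, IsPreconnected T ∧ y ∈ T ∧ y' ∈ T := by
  obtain ⟨φ, Q, h1, h2, h3, h4, h5, h6, h7, h8⟩ := hy
  exact ⟨φ '' Q, h6.image_subset, h2.isPreconnected.image φ h5.continuousOn, ⟨0, h3, h7⟩,
    ⟨1, h4, h8⟩⟩

theorem isOpen_preimage_lineMap {W : Set E} (hW : IsOpen W) (y y' : E) :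
    IsOpen {τ : ℂ | y + τ • (y' - y) ∈ W} :=
  hW.preimage (by fun_prop : Continuous fun τ : ℂ => y + τ • (y' - y))

theorem convex_preimage_lineMap {W : Set E} (hW : Convex ℝ W) (y y' : E) :
    Convex ℝ {τ : ℂ | y + τ • (y' - y) ∈ W} := by
  intro τ hτ τ' hτ' a b ha hb hab
  have h := hW hτ hτ' ha hb hab
  simp only [Set.mem_ofPred_eq] at h ⊢
  convert h using 1
  rw [show y + (a • τ + b • τ') • (y' - y) = (a + b) • y + (a • τ + b • τ') • (y' - y) by
    rw [hab, one_smul]]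
  simp only [add_smul, smul_add, smul_assoc]
  abel

theorem Convex.discJoinedIn {W : Set E} (hW : Convex ℝ W) (hWo : IsOpen W) {y y' : E}
    (hy : y ∈ W) (hy' : y' ∈ W) : DiscJoinedIn W y y' :=
  ⟨fun τ => y + τ • (y' - y), {τ | y + τ • (y' - y) ∈ W}, isOpen_preimage_lineMap hWo y y',
    convex_preimage_lineMap hW y y', by simpa, by simpa, by fun_prop, fun τ hτ => hτ, by simp,
    by simp⟩

theorem DiscJoinedIn.prodMk {A : Set E} {y y' : E} (hy : DiscJoinedIn A y y') {W : Set E'}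
    (hW : Convex ℝ W) (hWo : IsOpen W) {z z' : E'} (hz : z ∈ W) (hz' : z' ∈ W) :
    DiscJoinedIn (A ×ˢ W) (y, z) (y', z') := by
  obtain ⟨φ, Q, h1, h2, h3, h4, h5, h6, h7, h8⟩ := hy
  obtain ⟨ψ, Q', g1, g2, g3, g4, g5, g6, g7, g8⟩ := hW.discJoinedIn hWo hz hz'
  exact ⟨fun τ => (φ τ, ψ τ), Q ∩ Q', h1.inter g1, h2.inter g2, ⟨h3, g3⟩, ⟨h4, g4⟩,
    (h5.mono inter_subset_left).prodMk (g5.mono inter_subset_right),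
    fun τ hτ => ⟨h6 hτ.1, g6 hτ.2⟩, by simp [h7, g7], by simp [h8, g8]⟩

theorem Convex.isDiscConnected {W : Set E} (hW : Convex ℝ W) (hWo : IsOpen W) :
    IsDiscConnected W := by
  refine ⟨hW.isPreconnected, fun x hx O hO => ?_⟩
  obtain ⟨ε, hε, hεO⟩ := Metric.mem_nhds_iff.1 (inter_mem (hWo.mem_nhds hx) hO)
  exact ⟨ball x ε, ball_mem_nhds x hε, fun y hy y' hy' =>
    ((convex_ball x ε).discJoinedIn isOpen_ball hy.2 hy'.2).mono hεO⟩

theorem IsDiscConnected.image {M : Set E} (hM : IsDiscConnected M) (e : E ≃L[ℂ] E') :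
    IsDiscConnected (e '' M) := by
  refine ⟨hM.1.image e e.continuous.continuousOn, ?_⟩
  rintro _ ⟨x, hx, rfl⟩ O hO
  obtain ⟨V, hV, h⟩ := hM.2 x hx (e ⁻¹' O) (e.continuous.continuousAt hO)
  refine ⟨e '' V, e.toHomeomorph.isOpenMap.image_mem_nhds hV, ?_⟩
  rintro _ ⟨⟨y, hy, rfl⟩, ⟨y₁, hyV, hy₁⟩⟩ _ ⟨⟨y', hy', rfl⟩, ⟨y₁', hyV', hy₁'⟩⟩
  obtain rfl := e.injective hy₁
  obtain rfl := e.injective hy₁'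
  exact (h _ ⟨hy, hyV⟩ _ ⟨hy', hyV'⟩).map (N := univ) (g := e) (by fun_prop) (subset_univ _)
    (fun z hz => ⟨mem_image_of_mem e hz.1, hz.2⟩)

end

theorem isPreconnected_ball_diff {c : ℂ} {r : ℝ} (hr : 0 < r) {T : Set ℂ} (hT : T.Countable) :
    IsPreconnected (ball c r \ T) := by
  set u := OpenPartialHomeomorph.univBall c r
  have hsrc : u.source = univ := OpenPartialHomeomorph.univBall_source c r
  have htgt : u.target = ball c r := OpenPartialHomeomorph.univBall_target c hr
  have hinj : Function.Injective u := injOn_univ.1 (hsrc ▸ u.injOn)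
  have himg : u '' univ = ball c r := by rw [← hsrc, u.image_source_eq_target, htgt]
  have h1 : IsPreconnected (u ⁻¹' T)ᶜ :=
    ((hT.preimage_of_injOn hinj.injOn).isConnected_compl_of_one_lt_rank
      (by simp [Complex.rank_real_complex])).isPreconnected
  have h2 := h1.image u (OpenPartialHomeomorph.continuous_univBall c r).continuousOn
  convert h2 using 1
  rw [← preimage_compl, image_preimage_eq_inter_range, ← image_univ, himg, inter_comm]
  rfl

section

variable {P : Type*} [NormedAddCommGroup P] [NormedSpace ℂ P] {M D : Set P} {c : ℂ} {r R : ℝ}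
  {F : P × ℂ → ℂ} {Z : P → Finset ℂ}

/-- The complement of the zeros in a cylinder over a disc-connected set is disc-connected. -/
theorem IsDiscConnected.compl_zeros (hM : IsDiscConnected M) (hD : IsOpen D) (hMD : M ⊆ D)
    (hr : 0 < r) (hrR : r ≤ R) (hF : ContDiffOn ℂ 1 F (D ×ˢ ball c R))
    (hZ : ∀ x ∈ D, ∀ t, t ∈ Z x ↔ t ∈ ball c r ∧ F (x, t) = 0) {t₁ : ℂ} (ht₁ : t₁ ∈ ball c r)
    (hFt₁ : ∀ x ∈ M, F (x, t₁) ≠ 0) :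
    IsDiscConnected {z : P × ℂ | z.1 ∈ M ∧ z.2 ∈ ball c r ∧ F z ≠ 0} := by
  constructor
  · rcases M.eq_empty_or_nonempty with rfl | ⟨x₁, hx₁⟩
    · simpa using isPreconnected_empty
    · refine isPreconnected_of_forall (x₁, t₁) ?_
      rintro ⟨x, t⟩ ⟨hx, ht, hF0⟩
      refine ⟨(M ×ˢ {t₁}) ∪ ({x} ×ˢ (ball c r \ Z x)), ?_, Or.inl ⟨hx₁, rfl⟩,
        Or.inr ⟨rfl, ht, fun h => hF0 ((hZ x (hMD hx) t).1 h).2⟩, ?_⟩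
      · rintro ⟨y, s⟩ (⟨hy, hs⟩ | ⟨hy, hs, hs'⟩)
        · obtain rfl := hs
          exact ⟨hy, ht₁, hFt₁ y hy⟩
        · obtain rfl := hy
          exact ⟨hx, hs, fun h => hs' ((hZ y (hMD hx) s).2 ⟨hs, h⟩)⟩
      · exact IsPreconnected.union (x, t₁) ⟨hx, rfl⟩
          ⟨rfl, ht₁, fun h => hFt₁ x hx ((hZ x (hMD hx) t₁).1 h).2⟩
          (hM.1.prod isPreconnected_singleton)
          (isPreconnected_singleton.prod (isPreconnected_ball_diff hr (Z x).countable_toSet))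
  · rintro ⟨x, t⟩ ⟨hx, ht, hF0⟩ O hO
    have hcyl : D ×ˢ ball c r ∈ 𝓝 (x, t) := (hD.prod isOpen_ball).mem_nhds ⟨hMD hx, ht⟩
    have hne : ∀ᶠ z in 𝓝 (x, t), F z ≠ 0 :=
      (hF.continuousOn.continuousAt ((hD.prod isOpen_ball).mem_nhds
        ⟨hMD hx, ball_subset_ball hrR ht⟩)).eventually_ne hF0
    obtain ⟨U, hU, W, hW, hUW⟩ := mem_nhds_prod_iff.1 (inter_mem (inter_mem hO hcyl) hne)
    obtain ⟨ε, hε, hεW⟩ := Metric.mem_nhds_iff.1 hW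
    obtain ⟨V, hV, h⟩ := hM.2 x hx U hU
    refine ⟨V ×ˢ ball t ε, prod_mem_nhds hV (ball_mem_nhds t hε), ?_⟩
    rintro ⟨y, s⟩ ⟨⟨hy, -⟩, hyV, hs⟩ ⟨y', s'⟩ ⟨⟨hy', -⟩, hyV', hs'⟩
    refine ((h y ⟨hy, hyV⟩ y' ⟨hy', hyV'⟩).prodMk (convex_ball t ε) isOpen_ball hs hs').mono ?_
    rintro ⟨w, τ⟩ ⟨⟨hw, hwU⟩, hτ⟩
    have := hUW (mk_mem_prod hwU (hεW hτ))
    exact ⟨⟨hw, this.1.2.2, this.2⟩, this.1.1⟩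

/-- Over a disc-connected set where the number of distinct zeros is constant, nearby zeros are
joined by graphs of holomorphic functions over discs. -/
theorem IsDiscConnected.exists_zeros_discJoinedIn (hM : IsDiscConnected M) (hD : IsOpen D)
    (hMD : M ⊆ D) (hrR : r ≤ R) (hF : ContDiffOn ℂ 1 F (D ×ˢ ball c R))
    (hZ : ∀ x ∈ D, ∀ t, t ∈ Z x ↔ t ∈ ball c r ∧ F (x, t) = 0)
    (hcard : ∀ x ∈ M, ∀ y ∈ M, (Z x).card = (Z y).card) {x : P} (hx : x ∈ M) :
    ∃ ρ > 0, ∀ O : ℂ → Set (P × ℂ), (∀ t ∈ Z x, O t ∈ 𝓝 (x, t)) →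
      ∃ V ∈ 𝓝 x, (∀ y ∈ M ∩ V, ∀ t ∈ Z y, ∃ a ∈ Z x, ∀ y' ∈ M ∩ V, ∃ t' ∈ Z y',
        DiscJoinedIn ({z : P × ℂ | z.1 ∈ M ∧ z.2 ∈ Z z.1} ∩ O a) (y, t) (y', t')) ∧
        ∀ a ∈ Z x, ∀ y ∈ M ∩ V, ∀ t ∈ Z y, t ∈ ball a ρ → ∀ y' ∈ M ∩ V, ∀ t' ∈ Z y',
          t' ∈ ball a ρ →
          DiscJoinedIn ({z : P × ℂ | z.1 ∈ M ∧ z.2 ∈ Z z.1} ∩ O a) (y, t) (y', t') := by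
  obtain ⟨N, hND, hN, hxN, ρ, hρ, σ, hσ, hσZ⟩ := exists_local_sections hD hrR hF hZ (hMD hx)
  refine ⟨ρ, hρ, fun O hO => ?_⟩
  have hev : ∀ᶠ y in 𝓝 x, y ∈ N ∧ ∀ a ∈ Z x, (y, σ a y) ∈ O a := by
    refine (hN.eventually_mem hxN).and ((Finset.eventually_all _).2 fun a ha => ?_)
    have hc : ContinuousAt (fun y => (y, σ a y)) x :=
      continuousAt_id.prodMk ((hσ a ha).1.continuousOn.continuousAt (hN.mem_nhds hxN))
    exact hc (by simpa only [(hσ a ha).2] using hO a ha)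
  obtain ⟨V, hV, h⟩ := hM.2 x hx _ hev
  have hVN : ∀ y ∈ M ∩ V, y ∈ N := fun y hy => by
    obtain ⟨φ, Q, -, -, h0, -, -, hm, h0', -⟩ := h y hy y hy
    exact h0' ▸ (hm h0).2.1
  have hjoin : ∀ a ∈ Z x, ∀ y ∈ M ∩ V, ∀ y' ∈ M ∩ V,
      DiscJoinedIn ({z : P × ℂ | z.1 ∈ M ∧ z.2 ∈ Z z.1} ∩ O a) (y, σ a y) (y', σ a y') := by
    intro a ha y hy y' hy'
    refine (h y hy y' hy').map (g := fun y => (y, σ a y)) (N := N)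
      (differentiableOn_id.prodMk ((hσ a ha).1.differentiableOn one_ne_zero))
      (fun z hz => hz.2.1) fun z hz => ⟨⟨hz.1, ?_⟩, hz.2.2 a ha⟩
    exact ((hσZ z hz.2.1 (hcard z hz.1 x hx)).1 a ha).1
  refine ⟨V, hV, fun y hy t ht => ?_, fun a ha y hy t ht hta y' hy' t' ht' hta' => ?_⟩
  · obtain ⟨a, ha, rfl⟩ := (hσZ y (hVN y hy) (hcard y hy.1 x hx)).2 t ht
    exact ⟨a, ha, fun y' hy' => ⟨σ a y', ((hσZ y' (hVN y' hy') (hcard y' hy'.1 x hx)).1 a ha).1,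
      hjoin a ha y hy y' hy'⟩⟩
  · rw [((hσZ y (hVN y hy) (hcard y hy.1 x hx)).1 a ha).2 t ht hta,
      ((hσZ y' (hVN y' hy') (hcard y' hy'.1 x hx)).1 a ha).2 t' ht' hta']
    exact (hjoin a ha y hy y' hy' :)

/-- The zeros over a disc-connected set where their number is constant form finitely many
disc-connected pieces, on each of which a given function whose zeros are among them either vanishes
identically or has no zero. -/
theorem IsDiscConnected.exists_strata_zeros (hM : IsDiscConnected M) (hD : IsOpen D) (hMD : M ⊆ D)
    (hrR : r ≤ R) (hF : ContDiffOn ℂ 1 F (D ×ˢ ball c R))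
    (hZ : ∀ x ∈ D, ∀ t, t ∈ Z x ↔ t ∈ ball c r ∧ F (x, t) = 0)
    (hcard : ∀ x ∈ M, ∀ y ∈ M, (Z x).card = (Z y).card) {ι : Type*} [Finite ι]
    {f : ι → P × ℂ → ℂ} (hf : ∀ i, ContDiffOn ℂ 1 (f i) (D ×ˢ ball c R))
    (hfF : ∀ i, ∀ x ∈ D, ∀ t ∈ ball c r, f i (x, t) = 0 → F (x, t) = 0) :
    ∃ 𝓢 : Set (Set (P × ℂ)), 𝓢.Finite ∧ ⋃₀ 𝓢 = {z : P × ℂ | z.1 ∈ M ∧ z.2 ∈ Z z.1} ∧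
      ∀ S ∈ 𝓢, IsDiscConnected S ∧ ∀ i, (∀ z ∈ S, f i z = 0) ∨ ∀ z ∈ S, f i z ≠ 0 := by
  set Y : Set (P × ℂ) := {z | z.1 ∈ M ∧ z.2 ∈ Z z.1} with hY
  have hcomp : ∀ {A : Set (P × ℂ)} {z z' : P × ℂ}, DiscJoinedIn (Y ∩ A) z z' →
      z' ∈ connectedComponentIn Y z := by
    intro A z z' h
    obtain ⟨T, hT, hTc, hz, hz'⟩ := h.exists_isPreconnected
    exact hTc.subset_connectedComponentIn hz (hT.trans inter_subset_left) hz'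
  have hmeet : ∀ y ∈ M, ∀ y' ∈ M, ∀ t ∈ Z y, ∃ t' ∈ Z y',
      (y', t') ∈ connectedComponentIn Y (y, t) := by
    intro y hy y' hy'
    refine hM.1.induction₂' (fun y y' => ∀ t ∈ Z y, ∃ t' ∈ Z y',
      (y', t') ∈ connectedComponentIn Y (y, t)) ?_ ?_ hy hy'
    · intro x hx
      obtain ⟨ρ, hρ, h⟩ := hM.exists_zeros_discJoinedIn hD hMD hrR hF hZ hcard hx
      obtain ⟨V, hV, hVj, -⟩ := h (fun _ => univ) (fun _ _ => univ_mem)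
      filter_upwards [self_mem_nhdsWithin, mem_nhdsWithin_of_mem_nhds hV] with y hy hyV
      refine ⟨fun t ht => ?_, fun t ht => ?_⟩
      · obtain ⟨a, ha, hj⟩ := hVj x ⟨hx, mem_of_mem_nhds hV⟩ t ht
        obtain ⟨t', ht', hd⟩ := hj y ⟨hy, hyV⟩
        exact ⟨t', ht', hcomp hd⟩
      · obtain ⟨a, ha, hj⟩ := hVj y ⟨hy, hyV⟩ t ht
        obtain ⟨t', ht', hd⟩ := hj x ⟨hx, mem_of_mem_nhds hV⟩
        exact ⟨t', ht', hcomp hd⟩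
    · intro x y z hx hy hz hxy hyz t ht
      obtain ⟨t', ht', h'⟩ := hxy t ht
      obtain ⟨t'', ht'', h''⟩ := hyz t' ht'
      exact ⟨t'', ht'', by rwa [connectedComponentIn_eq h']⟩
  refine ⟨connectedComponentIn Y '' Y, ?_, ?_, ?_⟩
  · rcases M.eq_empty_or_nonempty with rfl | ⟨x₁, hx₁⟩
    · simp [hY]
    · refine ((Z x₁).finite_toSet.image fun t => connectedComponentIn Y (x₁, t)).subset ?_
      rintro _ ⟨⟨y, t⟩, hz, rfl⟩
      obtain ⟨t', ht', h⟩ := hmeet y hz.1 x₁ hx₁ t hz.2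
      exact ⟨t', ht', (connectedComponentIn_eq h).symm⟩
  · refine subset_antisymm (sUnion_subset ?_) fun z hz =>
      ⟨_, mem_image_of_mem _ hz, mem_connectedComponentIn hz⟩
    rintro _ ⟨z, -, rfl⟩
    exact connectedComponentIn_subset Y z
  · rintro _ ⟨z₀, hz₀, rfl⟩
    have hsub := connectedComponentIn_subset Y z₀
    refine ⟨⟨isPreconnected_connectedComponentIn, ?_⟩, fun i => ?_⟩
    · rintro ⟨x, a⟩ hxa O hO
      obtain ⟨hx, ha⟩ := hsub hxa
      obtain ⟨ρ, hρ, h⟩ := hM.exists_zeros_discJoinedIn hD hMD hrR hF hZ hcard hx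
      classical
      obtain ⟨V, hV, -, hVj⟩ := h (fun t => if t = a then O else univ) (fun t _ => by
        split_ifs with hta
        · rwa [hta]
        · exact univ_mem)
      refine ⟨V ×ˢ ball a ρ, prod_mem_nhds hV (ball_mem_nhds a hρ), ?_⟩
      rintro ⟨y, t⟩ ⟨hyt, hyV, hta⟩ ⟨y', t'⟩ ⟨hyt', hyV', hta'⟩
      have hj := hVj a ha y ⟨(hsub hyt).1, hyV⟩ t (hsub hyt).2 hta y' ⟨(hsub hyt').1, hyV'⟩ t'
        (hsub hyt').2 hta'
      simp only [if_true] at hj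
      obtain ⟨φ, Q, h1, h2, h3, h4, h5, h6, h7, h8⟩ := hj
      refine ⟨φ, Q, h1, h2, h3, h4, h5, fun τ hτ => ⟨?_, (h6 hτ).2⟩, h7, h8⟩
      rw [connectedComponentIn_eq hyt, ← h7]
      exact (h2.isPreconnected.image φ h5.continuousOn).subset_connectedComponentIn (F := Y)
        (mem_image_of_mem φ h3) (image_subset_iff.2 fun τ hτ => (h6 hτ).1 : φ '' Q ⊆ Y)
        (mem_image_of_mem φ hτ)
    · have hiff : ∀ z ∈ connectedComponentIn Y z₀, ∀ z' ∈ connectedComponentIn Y z₀,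
          (f i z = 0 → f i z' = 0) := by
        intro z hz z' hz'
        refine isPreconnected_connectedComponentIn.induction₂' (fun z z' => f i z = 0 → f i z' = 0)
          ?_ (fun _ _ _ _ _ _ h h' h0 => h' (h h0)) hz hz'
        rintro ⟨x, a⟩ hxa
        obtain ⟨hx, ha⟩ := hsub hxa
        have haZ := (hZ x (hMD hx) a).1 ha
        have hnb : D ×ˢ ball c R ∈ 𝓝 (x, a) :=
          (hD.prod isOpen_ball).mem_nhds ⟨hMD hx, ball_subset_ball hrR haZ.1⟩
        by_cases h0 : f i (x, a) = 0
        · obtain ⟨N, hND, hN, hxN, ρ, hρ, σ, hσ, hσZ⟩ :=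
            exists_local_sections hD hrR hF hZ (hMD hx)
          obtain ⟨ε, hε, hεb⟩ := Metric.isOpen_iff.1 (isOpen_ball (x := c) (ε := r)) a haZ.1
          have hiso : ∀ᶠ t in 𝓝[≠] a, f i (x, t) ≠ 0 := by
            have h1 : ∀ᶠ t in 𝓝[≠] a, t ∉ (Z x).erase a :=
              nhdsWithin_le_nhds (((Z x).erase a).finite_toSet.isClosed.isOpen_compl.mem_nhds
                (by simp))
            filter_upwards [h1, self_mem_nhdsWithin,
              nhdsWithin_le_nhds (ball_mem_nhds a hε)] with t ht hta htb hft
            exact ht (Finset.mem_erase.2 ⟨hta, (hZ x (hMD hx) t).2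
              ⟨hεb htb, hfF i x (hMD hx) t (hεb htb) hft⟩⟩)
          have hH := eventually_exists_zero_mem_ball hnb (hf i) h0 hiso (lt_min hρ hε)
          have hev : ∀ᶠ z : P × ℂ in 𝓝 (x, a), (z.1 ∈ N ∧
              ∃ t ∈ ball a (min ρ ε), f i (z.1, t) = 0) ∧ z.2 ∈ ball a ρ :=
            ((continuousAt_fst (p := (x, a))).eventually ((hN.eventually_mem hxN).and hH)).and
              ((continuousAt_snd (p := (x, a))).eventually (ball_mem_nhds a hρ))
          filter_upwards [self_mem_nhdsWithin, nhdsWithin_le_nhds hev] with z hz hzz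
          refine ⟨fun _ => ?_, fun _ => h0⟩
          obtain ⟨⟨hzN, t, ht, hft⟩, hzb⟩ := hzz
          obtain ⟨hzM, hzZ⟩ := hsub hz
          have htb := hεb (ball_subset_ball (min_le_right _ _) ht)
          have hu := (hσZ z.1 hzN (hcard z.1 hzM x hx)).1 a ha
          have e1 := hu.2 z.2 hzZ hzb
          have e2 := hu.2 t ((hZ z.1 (hMD hzM) t).2 ⟨htb, hfF i z.1 (hMD hzM) t htb hft⟩)
            (ball_subset_ball (min_le_left _ _) ht)
          rw [show z = (z.1, t) from Prod.ext rfl (e1.trans e2.symm)]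
          exact hft
        · have := ((hf i).continuousOn.continuousAt hnb).eventually_ne h0
          filter_upwards [nhdsWithin_le_nhds this] with z hz
          exact ⟨fun h => absurd h h0, fun h => absurd h hz⟩
      by_cases h : ∃ z ∈ connectedComponentIn Y z₀, f i z = 0
      · obtain ⟨z, hz, h0⟩ := h
        exact Or.inl fun z' hz' => hiff z hz z' hz' h0
      · push Not at h
        exact Or.inr h

end

/-- A holomorphic function vanishing on an open subset of a convex open set vanishes on it. -/
theorem eqOn_zero_of_eventually_zero {E : Type*} [NormedAddCommGroup E] [NormedSpace ℂ E]
    {D : Set E} (hDo : IsOpen D) (hD : Convex ℝ D) {f : E → ℂ} (hf : DifferentiableOn ℂ f D)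
    {q : E} (hq : q ∈ D) (h0 : ∀ᶠ x in 𝓝 q, f x = 0) : ∀ x ∈ D, f x = 0 := by
  intro y hy
  have hline : Continuous fun τ : ℂ => q + τ • (y - q) := by fun_prop
  have hg : DifferentiableOn ℂ (fun τ : ℂ => f (q + τ • (y - q))) {τ | q + τ • (y - q) ∈ D} :=
    hf.comp (f := fun τ : ℂ => q + τ • (y - q)) (by fun_prop) fun τ hτ => hτ
  have h := (hg.analyticOnNhd (isOpen_preimage_lineMap hDo q y)).eqOn_zero_of_preconnected_of_eventuallyEq_zero
    (convex_preimage_lineMap hD q y).isPreconnected (z₀ := 0) (by simpa)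
    ((hline.tendsto' 0 q (by simp)).eventually h0)
  have := h (show (1 : ℂ) ∈ {τ : ℂ | q + τ • (y - q) ∈ D} by simpa)
  simpa using this

/-- Linear coordinates in which a holomorphic function has an isolated zero in the last variable. -/
theorem exists_regular_coordinates {E : Type*} [NormedAddCommGroup E] [NormedSpace ℂ E]
    [FiniteDimensional ℂ E] {D : Set E} (hD : IsOpen D) {q : E} (hq : q ∈ D) {F : E → ℂ}
    (hF : DifferentiableOn ℂ F D) (hF0 : F q = 0) (hne : ¬ ∀ᶠ x in 𝓝 q, F x = 0) :
    ∃ (E' : Submodule ℂ E) (e : (E' × ℂ) ≃L[ℂ] E) (x₀ : E') (t₀ : ℂ) (R : ℝ) (B : Set E'),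
      Module.finrank ℂ E' < Module.finrank ℂ E ∧ e (x₀, t₀) = q ∧ 0 < R ∧ IsOpen B ∧ x₀ ∈ B ∧
      (∀ x ∈ B, ∀ t ∈ ball t₀ R, e (x, t) ∈ D) ∧
      ∀ t ∈ ball t₀ R, t ≠ t₀ → F (e (x₀, t)) ≠ 0 := by
  obtain ⟨ε, hε, hεD⟩ := Metric.isOpen_iff.1 hD q hq
  obtain ⟨y, hy0, hy⟩ : ∃ y, F y ≠ 0 ∧ y ∈ ball q ε :=
    ((not_eventually.1 hne).and_eventually (ball_mem_nhds q hε)).exists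
  set v := y - q with hv
  have hv0 : v ≠ 0 := by
    rw [hv, sub_ne_zero]
    rintro rfl
    exact hy0 hF0
  have hline : Continuous fun τ : ℂ => q + τ • v := by fun_prop
  have hopen := isOpen_preimage_lineMap (isOpen_ball (x := q) (ε := ε)) q y
  have hg : DifferentiableOn ℂ (fun τ : ℂ => F (q + τ • v)) {τ : ℂ | q + τ • v ∈ ball q ε} :=
    hF.comp (f := fun τ : ℂ => q + τ • v) (by fun_prop) fun τ hτ => hεD hτ
  have hmem0 : (0 : ℂ) ∈ {τ : ℂ | q + τ • v ∈ ball q ε} := by simpa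
  have hga := hg.analyticOnNhd hopen
  have hpunct : ∀ᶠ τ in 𝓝[≠] (0 : ℂ), F (q + τ • v) ≠ 0 := by
    refine ((hga 0 hmem0).eventually_eq_zero_or_eventually_ne_zero).resolve_left fun h => hy0 ?_
    have := hga.eqOn_zero_of_preconnected_of_eventuallyEq_zero
      (convex_preimage_lineMap (convex_ball q ε) q y).isPreconnected hmem0 h
      (show (1 : ℂ) ∈ {τ : ℂ | q + τ • v ∈ ball q ε} by simpa [hv, ← dist_eq_norm] using hy)
    simpa [hv] using this
  obtain ⟨E', hE'⟩ := (ℂ ∙ v).exists_isCompl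
  set e : (E' × ℂ) ≃L[ℂ] E := (((LinearEquiv.refl ℂ E').prodCongr
    (LinearEquiv.toSpanNonzeroSingleton ℂ E v hv0)).trans
    (Submodule.prodEquivOfIsCompl E' (ℂ ∙ v) hE'.symm)).toContinuousLinearEquiv with he
  have hev : ∀ (x : E') (t : ℂ), e (x, t) = x + t • v := by
    intro x t
    simp [he, Submodule.coe_prodEquivOfIsCompl', LinearEquiv.toSpanNonzeroSingleton_apply]
  obtain ⟨⟨x₀, t₀⟩, hxt⟩ := e.surjective q
  have hat : ∀ t : ℂ, e (x₀, t) = q + (t - t₀) • v := by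
    intro t
    rw [← hxt, hev, hev, sub_smul]
    abel
  have hDn : e ⁻¹' D ∈ 𝓝 (x₀, t₀) :=
    e.continuous.continuousAt (hD.mem_nhds (by rw [hxt]; exact hq))
  obtain ⟨U, hU, W, hW, hUW⟩ := mem_nhds_prod_iff.1 hDn
  obtain ⟨B, hBU, hB, hxB⟩ := _root_.mem_nhds_iff.1 hU
  obtain ⟨R₁, hR₁, hR₁W⟩ := Metric.mem_nhds_iff.1 hW
  obtain ⟨R₂, hR₂, hR₂h⟩ := Metric.mem_nhds_iff.1 (eventually_nhdsWithin_iff.1 hpunct)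
  refine ⟨E', e, x₀, t₀, min R₁ R₂, B, ?_, hxt, lt_min hR₁ hR₂, hB, hxB, fun x hx t ht =>
    hUW (mk_mem_prod (hBU hx) (hR₁W (ball_subset_ball (min_le_left _ _) ht))), fun t ht htne => ?_⟩
  · rw [← e.toLinearEquiv.finrank_eq, Module.finrank_prod]
    simp
  · rw [hat]
    refine hR₂h (a := t - t₀) ?_ (sub_ne_zero.2 htne)
    have := ball_subset_ball (min_le_right R₁ R₂) ht
    simpa [dist_eq_norm] using this

theorem ContDiffOn.matrix_det {P : Type*} [NormedAddCommGroup P] [NormedSpace ℂ P] {k : ℕ}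
    {U : Set P} {a : P → Fin k → Fin k → ℂ} (ha : ∀ i j, ContDiffOn ℂ 1 (fun x => a x i j) U) :
    ContDiffOn ℂ 1 (fun x => (Matrix.of (a x)).det) U := by
  simp only [Matrix.det_apply, Matrix.of_apply]
  exact ContDiffOn.sum fun σ _ => (contDiffOn_prod fun i _ => ha _ _).const_smul _

theorem not_eventually_mul_zero {E : Type*} [NormedAddCommGroup E] [NormedSpace ℂ E]
    {D : Set E} {q : E} (hD : D ∈ 𝓝 q) {f g : E → ℂ} (hf : DifferentiableOn ℂ f D)
    (hg : ContinuousOn g D) (hf0 : ¬ ∀ᶠ x in 𝓝 q, f x = 0) (hg0 : ¬ ∀ᶠ x in 𝓝 q, g x = 0) :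
    ¬ ∀ᶠ x in 𝓝 q, f x * g x = 0 := by
  intro h
  obtain ⟨ε, hε, hεD⟩ := Metric.mem_nhds_iff.1 (inter_mem h hD)
  obtain ⟨y, hy0, hy⟩ : ∃ y, g y ≠ 0 ∧ y ∈ ball q ε :=
    ((not_eventually.1 hg0).and_eventually (ball_mem_nhds q hε)).exists
  have hyn := isOpen_ball.mem_nhds hy
  have hy1 : ∀ᶠ x in 𝓝 y, f x = 0 := by
    have := (hg.continuousAt (mem_of_superset hyn fun x hx => (hεD hx).2)).eventually_ne hy0
    filter_upwards [this, hyn] with x hx hxb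
    exact (mul_eq_zero.1 (hεD hxb).1).resolve_right hx
  have := eqOn_zero_of_eventually_zero isOpen_ball (convex_ball q ε)
    (hf.mono fun x hx => (hεD hx).2) hy hy1
  exact hf0 (mem_of_superset (ball_mem_nhds q hε) this)

theorem not_eventually_prod_zero {E : Type*} [NormedAddCommGroup E] [NormedSpace ℂ E]
    {D : Set E} {q : E} (hD : D ∈ 𝓝 q) {ι : Type*} {f : ι → E → ℂ}
    (hf : ∀ i, DifferentiableOn ℂ (f i) D) (hf0 : ∀ i, ¬ ∀ᶠ x in 𝓝 q, f i x = 0) (s : Finset ι) :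
    ¬ ∀ᶠ x in 𝓝 q, ∏ i ∈ s, f i x = 0 := by
  classical
  induction s using Finset.induction_on with
  | empty => simpa using NeBot.ne (f := 𝓝 q) inferInstance
  | insert a s ha ih =>
    simp only [Finset.prod_insert ha]
    exact not_eventually_mul_zero hD (hf a)
      (continuousOn_finsetProd _ fun i _ => (hf i).continuousOn) (hf0 a) ih

/-- Finitely many holomorphic functions near a point of a finite-dimensional space have, near that
point, a finite decomposition into disc-connected sets on each of which every function either
vanishes identically or has no zero. -/
theorem exists_stratification.{u} (n : ℕ) : ∀ (E : Type u) [NormedAddCommGroup E] [NormedSpace ℂ E]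
    [FiniteDimensional ℂ E], Module.finrank ℂ E = n → ∀ (D : Set E) (q : E), IsOpen D → q ∈ D →
    ∀ (ι : Type) [Finite ι] (f : ι → E → ℂ), (∀ i, ContDiffOn ℂ 1 (f i) D) →
    ∃ D₁ ⊆ D, IsOpen D₁ ∧ q ∈ D₁ ∧ ∃ 𝓜 : Set (Set E), 𝓜.Finite ∧ ⋃₀ 𝓜 = D₁ ∧
      ∀ M ∈ 𝓜, IsDiscConnected M ∧ ∀ i, (∀ x ∈ M, f i x = 0) ∨ ∀ x ∈ M, f i x ≠ 0 := by
  induction n using Nat.strong_induction_on with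
  | _ n ih =>
  intro E _ _ _ hn D q hD hq ι _ f hf
  classical
  obtain ⟨ε, hε, hεD⟩ := Metric.isOpen_iff.1 hD q hq
  have hqε := mem_ball_self (x := q) hε
  have hfε : ∀ i, ContDiffOn ℂ 1 (f i) (ball q ε) := fun i => (hf i).mono hεD
  have hdichotomy : ∀ i, (∀ᶠ x in 𝓝 q, f i x = 0) → ∀ x ∈ ball q ε, f i x = 0 := fun i hi =>
    eqOn_zero_of_eventually_zero isOpen_ball (convex_ball q ε)
      ((hfε i).differentiableOn one_ne_zero) hqε hi
  let J := {i // ¬ ∀ᶠ x in 𝓝 q, f i x = 0}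
  have : Fintype J := Fintype.ofFinite J
  set F : E → ℂ := fun x => ∏ j : J, f j x with hFdef
  have hF : ContDiffOn ℂ 1 F (ball q ε) := contDiffOn_prod fun j _ => hfε j
  have hFne : ¬ ∀ᶠ x in 𝓝 q, F x = 0 := not_eventually_prod_zero (ball_mem_nhds q hε)
    (fun j : J => (hfε j).differentiableOn one_ne_zero) (fun j => j.2) _
  have hfF : ∀ (j : J) x, f j x = 0 → F x = 0 := fun j x h =>
    Finset.prod_eq_zero (Finset.mem_univ j) h
  by_cases hF0 : F q = 0
  · obtain ⟨E', e, x₀, t₀, R, B, hfin, heq, hR, hB, hxB, hBR, hFR⟩ := exists_regular_coordinates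
      isOpen_ball hqε (hF.differentiableOn one_ne_zero) hF0 hFne
    have hcomp : ∀ g : E → ℂ, ContDiffOn ℂ 1 g (ball q ε) →
        ContDiffOn ℂ 1 (fun z => g (e z)) (B ×ˢ ball t₀ R) := fun g hg =>
      hg.comp e.contDiff.contDiffOn fun z hz => hBR z.1 hz.1 z.2 hz.2
    obtain ⟨r, hr, hrR⟩ := exists_between hR
    obtain ⟨δ, hδ, hδr⟩ := exists_between hr
    obtain ⟨D', hD'B, hD', hxD', m, A, -, hcard, hA, hsum⟩ := exists_parametric_zeros hB hxB hr hrR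
      (hcomp F hF) fun t ht => hFR t (mem_ball.2 ((mem_sphere.1 ht).trans_lt hrR)) (by
        rintro rfl
        simp [hr.ne] at ht)
    have ht₁ : t₀ + δ ∈ ball t₀ r := by simpa [abs_of_pos hδ] using hδr
    have ht₁R := ball_subset_ball hrR.le ht₁
    set D'' := D' ∩ (fun x => F (e (x, t₀ + δ))) ⁻¹' {0}ᶜ
    have hDD : D'' ⊆ D' := inter_subset_left
    have hD'' : IsOpen D'' := ((hcomp F hF).continuousOn.comp (f := fun x => (x, t₀ + (δ : ℂ)))
      (by fun_prop) fun x hx => ⟨hD'B hx, ht₁R⟩).isOpen_inter_preimage hD' isOpen_compl_singleton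
    have hxD'' : x₀ ∈ D'' := ⟨hxD', hFR _ ht₁R (by simpa using hδ.ne')⟩
    have hcomp'' : ∀ g : E → ℂ, ContDiffOn ℂ 1 g (ball q ε) →
        ContDiffOn ℂ 1 (fun z => g (e z)) (D'' ×ˢ ball t₀ R) := fun g hg =>
      (hcomp g hg).mono (prod_mono_left (hDD.trans hD'B))
    obtain ⟨D₁, hD₁D'', hD₁, hxD₁, 𝓜, h𝓜f, h𝓜D, h𝓜⟩ := ih _ (hn ▸ hfin) E' rfl D'' x₀ hD'' hxD''
      (Fin (m + 1)) (fun k x => hankelDet (A x) k) fun k =>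
        ContDiffOn.matrix_det fun i j => hsum D'' hDD hD'' (fun z => z.2 ^ (i + j : ℕ))
          (by fun_prop)
    have hMD'' : ∀ M ∈ 𝓜, M ⊆ D'' := fun M hM =>
      (subset_sUnion_of_mem hM).trans (h𝓜D.subset.trans hD₁D'')
    have hZ : ∀ x ∈ D'', ∀ t, t ∈ (A x).toFinset ↔ t ∈ ball t₀ r ∧ F (e (x, t)) = 0 :=
      fun x hx t => by rw [Multiset.mem_toFinset]; exact hA x (hDD hx) t
    have hle : ∀ M ∈ 𝓜, ∀ x ∈ M, ∀ y ∈ M, (A x).toFinset.card ≤ (A y).toFinset.card := by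
      intro M hM x hx y hy
      refine card_toFinset_le_of_hankelDet fun k hk h0 => ?_
      rw [hcard x (hDD (hMD'' M hM hx))] at hk
      rcases (h𝓜 M hM).2 ⟨k, Nat.lt_succ_of_le hk⟩ with h | h
      · exact absurd (h x hx) h0
      · exact h y hy
    have hstrata : ∀ M, ∃ 𝓢 : Set (Set (E' × ℂ)), M ∈ 𝓜 → 𝓢.Finite ∧
        ⋃₀ 𝓢 = {z : E' × ℂ | z.1 ∈ M ∧ z.2 ∈ (A z.1).toFinset} ∧
        ∀ S ∈ 𝓢, IsDiscConnected S ∧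
          ∀ j : J, (∀ z ∈ S, f j (e z) = 0) ∨ ∀ z ∈ S, f j (e z) ≠ 0 := by
      intro M
      by_cases hM : M ∈ 𝓜
      · obtain ⟨𝓢, h𝓢⟩ := (h𝓜 M hM).1.exists_strata_zeros hD'' (hMD'' M hM) hrR.le (hcomp'' F hF) hZ
          (fun x hx y hy => le_antisymm (hle M hM x hx y hy) (hle M hM y hy x hx))
          (f := fun (j : J) z => f j (e z)) (fun j => hcomp'' _ (hfε j)) fun j x _ t _ => hfF j _
        exact ⟨𝓢, fun _ => h𝓢⟩
      · exact ⟨∅, fun h => absurd h hM⟩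
    choose 𝓢 h𝓢 using hstrata
    set C : Set E' → Set (E' × ℂ) := fun M => {z | z.1 ∈ M ∧ z.2 ∈ ball t₀ r ∧ F (e z) ≠ 0}
    have hunion : ∀ M ∈ 𝓜, ⋃₀ insert (C M) (𝓢 M) = M ×ˢ ball t₀ r := by
      intro M hM
      rw [sUnion_insert, (h𝓢 M hM).2.1]
      ext ⟨x, t⟩
      constructor
      · rintro (⟨hx, ht, -⟩ | ⟨hx, ht⟩)
        · exact ⟨hx, ht⟩
        · exact ⟨hx, ((hZ x (hMD'' M hM hx) t).1 ht).1⟩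
      · rintro ⟨hx, ht⟩
        by_cases h0 : F (e (x, t)) = 0
        · exact Or.inr ⟨hx, (hZ x (hMD'' M hM hx) t).2 ⟨ht, h0⟩⟩
        · exact Or.inl ⟨hx, ht, h0⟩
    have hD₁ball : e '' (D₁ ×ˢ ball t₀ r) ⊆ ball q ε := by
      rintro _ ⟨⟨x, t⟩, ⟨hx, ht⟩, rfl⟩
      exact hBR x (hD'B (hDD (hD₁D'' hx))) t (ball_subset_ball hrR.le ht)
    have hU : ⋃₀ (⋃ M ∈ 𝓜, (fun S => e '' S) '' insert (C M) (𝓢 M)) = e '' (D₁ ×ˢ ball t₀ r) := by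
      ext y
      simp only [mem_sUnion, mem_iUnion, mem_image, exists_prop]
      constructor
      · rintro ⟨_, ⟨M, hM, S, hS, rfl⟩, z, hz, rfl⟩
        have hz' : z ∈ M ×ˢ ball t₀ r := hunion M hM ▸ ⟨S, hS, hz⟩
        exact ⟨z, ⟨h𝓜D ▸ ⟨M, hM, hz'.1⟩, hz'.2⟩, rfl⟩
      · rintro ⟨z, ⟨hz₁, hz₂⟩, rfl⟩
        rw [← h𝓜D] at hz₁
        obtain ⟨M, hM, hzM⟩ := hz₁
        have hz' : z ∈ ⋃₀ insert (C M) (𝓢 M) := (hunion M hM).symm ▸ ⟨hzM, hz₂⟩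
        obtain ⟨S, hS, hz⟩ := hz'
        exact ⟨e '' S, ⟨M, hM, S, hS, rfl⟩, z, hz, rfl⟩
    refine ⟨e '' (D₁ ×ˢ ball t₀ r), hD₁ball.trans hεD,
      e.toHomeomorph.isOpenMap _ (hD₁.prod isOpen_ball), ⟨(x₀, t₀), ⟨hxD₁, mem_ball_self hr⟩, heq⟩,
      ⋃ M ∈ 𝓜, (fun S => e '' S) '' insert (C M) (𝓢 M),
      h𝓜f.biUnion fun M hM => ((h𝓢 M hM).1.insert _).image _, hU, ?_⟩
    intro S' hS'
    have hS'sub := (subset_sUnion_of_mem hS').trans (hU.subset.trans hD₁ball)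
    simp only [mem_iUnion] at hS'
    obtain ⟨M, hM, S, hS, rfl⟩ := hS'
    have hdc : IsDiscConnected S ∧
        ∀ j : J, (∀ z ∈ S, f j (e z) = 0) ∨ ∀ z ∈ S, f j (e z) ≠ 0 := by
      rcases hS with rfl | hS
      · exact ⟨(h𝓜 M hM).1.compl_zeros hD'' (hMD'' M hM) hr hrR.le (hcomp'' F hF) hZ ht₁
          fun x hx => (hMD'' M hM hx).2, fun j => Or.inr fun z hz h => hz.2.2 (hfF j _ h)⟩
      · exact (h𝓢 M hM).2.2 S hS
    refine ⟨hdc.1.image e, fun i => ?_⟩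
    by_cases hi : ∀ᶠ x in 𝓝 q, f i x = 0
    · exact Or.inl fun x hx => hdichotomy i hi x (hS'sub hx)
    · refine (hdc.2 ⟨i, hi⟩).imp ?_ ?_
      · rintro h _ ⟨z, hz, rfl⟩
        exact h z hz
      · rintro h _ ⟨z, hz, rfl⟩
        exact h z hz
  · have hev : ∀ᶠ x in 𝓝 q, F x ≠ 0 :=
      (hF.continuousOn.continuousAt (ball_mem_nhds q hε)).eventually_ne hF0
    obtain ⟨δ, hδ, hδF⟩ := Metric.mem_nhds_iff.1 (inter_mem hev (ball_mem_nhds q hε))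
    refine ⟨ball q δ, fun x hx => hεD (hδF hx).2, isOpen_ball, mem_ball_self hδ, {ball q δ},
      finite_singleton _, sUnion_singleton _, ?_⟩
    rintro _ rfl
    refine ⟨(convex_ball q δ).isDiscConnected isOpen_ball, fun i => ?_⟩
    by_cases hi : ∀ᶠ x in 𝓝 q, f i x = 0
    · exact Or.inl fun x hx => hdichotomy i hi x (hδF hx).2
    · exact Or.inr fun x hx h => (hδF hx).1 (hfF ⟨i, hi⟩ x h)

/-- A matrix with linearly independent rows has a nonzero maximal minor. -/
theorem exists_minor_det_ne_zero {K : Type*} [Field K] {k m : ℕ} (A : Matrix (Fin k) (Fin m) K)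
    (hA : LinearIndependent K A.row) :
    ∃ c : Fin k → Fin m, (A.submatrix id c).det ≠ 0 := by
  have hrank : Module.finrank K (Submodule.span K (Set.range A.col)) = k := by
    rw [← A.rank_eq_finrank_span_cols, hA.rank_matrix, Fintype.card_fin]
  obtain ⟨g, hg, hli⟩ : ∃ g : Fin k → Fin k → K, (∀ i, g i ∈ Set.range A.col) ∧
      LinearIndependent K g := by
    obtain ⟨g, hg, -, hli⟩ := Submodule.exists_fun_fin_finrank_span_eq K (Set.range A.col)
    exact ⟨g ∘ Fin.cast hrank.symm, fun i => hg _, hli.comp _ (Fin.cast_injective _)⟩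
  choose c hc using hg
  refine ⟨c, ?_⟩
  have hcols : LinearIndependent K (A.submatrix id c).col := by
    convert hli using 1
    exact funext hc
  exact ((Matrix.isUnit_iff_isUnit_det _).1
    (Matrix.linearIndependent_cols_iff_isUnit.1 hcols)).ne_zero

theorem mem_span_of_minors {K α : Type*} [Field K] {m : ℕ} {v : α → Fin m → K} {Λ : Set α}
    (h : ∀ k ≤ m, (∀ (s : Fin k → α) (c : Fin k → Fin m), (∀ i, s i ∈ Λ) →
      (Matrix.of fun i j => v (s i) (c j)).det = 0) →
      ∀ (s : Fin k → α) (c : Fin k → Fin m), (Matrix.of fun i j => v (s i) (c j)).det = 0) (a : α) :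
    v a ∈ Submodule.span K (v '' Λ) := by
  by_contra ha
  obtain ⟨g, hg, hspan, hli⟩ := Submodule.exists_fun_fin_finrank_span_eq K (v '' Λ)
  choose s hsΛ hs using hg
  have hcons : LinearIndependent K (Fin.cons (v a) g : Fin _ → Fin m → K) :=
    hli.finCons (by rwa [hspan])
  have hcons' : (Fin.cons (v a) g : Fin _ → Fin m → K) =
      fun i => v ((Fin.cons a s : Fin _ → α) i) := by
    funext i
    refine Fin.cases rfl (fun i => ?_) i
    simp [hs]
  rw [hcons'] at hcons
  obtain ⟨c, hc⟩ := exists_minor_det_ne_zero (Matrix.of fun i => v ((Fin.cons a s : Fin _ → α) i))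
    hcons
  refine hc (h _ (by simpa using hcons.fintype_card_le_finrank) (fun s' c' hs' => ?_) _ c)
  by_contra hdet
  have hli' : LinearIndependent K fun i => v (s' i) := by
    have := Matrix.linearIndependent_rows_of_det_ne_zero hdet
    exact LinearIndependent.of_comp (LinearMap.funLeft K K c') this
  have := (LinearIndependent.of_comp (Submodule.span K (v '' Λ)).subtype
    (v := fun i => (⟨v (s' i), Submodule.subset_span ⟨s' i, hs' i, rfl⟩⟩ :
      Submodule.span K (v '' Λ))) hli').fintype_card_le_finrank
  simp at this

/-- The power sums `∑ h t * t ^ j` over a multiset of points determine the values of `h` on it. -/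
theorem exists_linear_eval_of_moments {m : ℕ} {A : Multiset ℂ} (hA : A.card = m) {a : ℂ}
    (ha : a ∈ A) : ∃ (L : (Fin m → ℂ) →ₗ[ℂ] ℂ) (κ : ℂ), κ ≠ 0 ∧
      ∀ h : ℂ → ℂ, L (fun j => (A.map fun t => h t * t ^ (j : ℕ)).sum) = κ * h a := by
  classical
  set p : Polynomial ℂ := ∏ b ∈ A.toFinset.erase a, (Polynomial.X - Polynomial.C b) with hp
  have hdeg : p.natDegree < m := by
    rw [hp, Polynomial.natDegree_prod_of_monic _ _ fun b _ => Polynomial.monic_X_sub_C b]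
    simp only [Polynomial.natDegree_X_sub_C, Finset.sum_const, smul_eq_mul, mul_one]
    calc _ < A.toFinset.card := Finset.card_erase_lt_of_mem (Multiset.mem_toFinset.2 ha)
      _ ≤ _ := hA ▸ A.toFinset_card_le
  have hpa : p.eval a ≠ 0 := by
    rw [hp, Polynomial.eval_prod, Finset.prod_ne_zero_iff]
    intro b hb
    simpa [sub_eq_zero] using (Finset.ne_of_mem_erase hb).symm
  have hpb : ∀ b ∈ A, b ≠ a → p.eval b = 0 := by
    intro b hb hba
    rw [hp, Polynomial.eval_prod]
    exact Finset.prod_eq_zero (Finset.mem_erase.2 ⟨hba, Multiset.mem_toFinset.2 hb⟩) (by simp)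
  refine ⟨∑ j : Fin m, p.coeff j • LinearMap.proj j, A.count a * p.eval a,
    mul_ne_zero (by simpa using ha) hpa, fun h => ?_⟩
  simp only [Finset.sum_multiset_map_count, LinearMap.sum_apply, LinearMap.smul_apply,
    LinearMap.proj_apply, smul_eq_mul, nsmul_eq_mul, Finset.mul_sum]
  rw [Finset.sum_comm]
  have h₁ : ∀ t, ∑ j : Fin m, p.coeff j * (A.count t * (h t * t ^ (j : ℕ))) =
      A.count t * h t * p.eval t := by
    intro t
    rw [Polynomial.eval_eq_sum_range' hdeg, Finset.mul_sum,
      ← Fin.sum_univ_eq_sum_range (fun j => A.count t * h t * (p.coeff j * t ^ j))]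
    exact Finset.sum_congr rfl fun j _ => by ring
  simp only [h₁]
  rw [Finset.sum_eq_single_of_mem a (Multiset.mem_toFinset.2 ha) fun t ht hta => by
    rw [hpb t (Multiset.mem_toFinset.1 ht) hta, mul_zero]]
  ring

/-- Near a point, the common zero set of any family of holomorphic functions is the common zero set
of a finite subfamily. -/
theorem exists_finset_common_zeros.{u} (n : ℕ) : ∀ (E : Type u) [NormedAddCommGroup E]
    [NormedSpace ℂ E] [FiniteDimensional ℂ E], Module.finrank ℂ E = n → ∀ (D : Set E) (q : E),
    IsOpen D → q ∈ D → ∀ {α : Type} (f : α → E → ℂ), (∀ a, ContDiffOn ℂ 1 (f a) D) →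
    ∃ D₁ ⊆ D, IsOpen D₁ ∧ q ∈ D₁ ∧ ∃ Λ : Finset α, ∀ x ∈ D₁, (∀ a ∈ Λ, f a x = 0) →
      ∀ a, f a x = 0 := by
  induction n using Nat.strong_induction_on with
  | _ n ih =>
  intro E _ _ _ hn D q hD hq α f hf
  classical
  obtain ⟨ε, hε, hεD⟩ := Metric.isOpen_iff.1 hD q hq
  by_cases hall : ∀ a, ∀ᶠ x in 𝓝 q, f a x = 0
  · exact ⟨ball q ε, hεD, isOpen_ball, mem_ball_self hε, ∅, fun x hx _ a =>
      eqOn_zero_of_eventually_zero isOpen_ball (convex_ball q ε)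
        (((hf a).mono hεD).differentiableOn one_ne_zero) (mem_ball_self hε) (hall a) x hx⟩
  obtain ⟨a₀, ha₀⟩ := not_forall.1 hall
  by_cases hF0 : f a₀ q = 0
  · obtain ⟨E', e, x₀, t₀, R, B, hfin, heq, hR, hB, hxB, hBR, hFR⟩ := exists_regular_coordinates
      hD hq ((hf a₀).differentiableOn one_ne_zero) hF0 ha₀
    have hcomp : ∀ a, ContDiffOn ℂ 1 (fun z => f a (e z)) (B ×ˢ ball t₀ R) := fun a =>
      (hf a).comp e.contDiff.contDiffOn fun z hz => hBR z.1 hz.1 z.2 hz.2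
    obtain ⟨r, hr, hrR⟩ := exists_between hR
    obtain ⟨D', hD'B, hD', hxD', m, A, -, hcard, hA, hsum⟩ := exists_parametric_zeros hB hxB hr hrR
      (hcomp a₀) fun t ht => hFR t (mem_ball.2 ((mem_sphere.1 ht).trans_lt hrR)) (by
        rintro rfl
        simp [hr.ne] at ht)
    set v : E' → α → Fin m → ℂ := fun x a j =>
      ((A x).map fun t => f a (e (x, t)) * t ^ (j : ℕ)).sum with hv
    have hvD : ∀ a j, ContDiffOn ℂ 1 (fun x => v x a j) D' := fun a j =>
      hsum D' subset_rfl hD' (fun z => f a (e z) * z.2 ^ (j : ℕ))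
        (((hcomp a).mono (prod_mono_left hD'B)).mul (by fun_prop))
    have hminor : ∀ k : ℕ, ∃ D₁ ⊆ D', IsOpen D₁ ∧ x₀ ∈ D₁ ∧
        ∃ Λ : Finset ((Fin k → α) × (Fin k → Fin m)), ∀ x ∈ D₁,
          (∀ s ∈ Λ, (Matrix.of fun i j => v x (s.1 i) (s.2 j)).det = 0) →
          ∀ s : (Fin k → α) × (Fin k → Fin m),
            (Matrix.of fun i j => v x (s.1 i) (s.2 j)).det = 0 := fun k =>
      ih _ (hn ▸ hfin) E' rfl D' x₀ hD' hxD'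
        (fun (s : (Fin k → α) × (Fin k → Fin m)) x =>
          (Matrix.of fun i j => v x (s.1 i) (s.2 j)).det)
        fun s => ContDiffOn.matrix_det fun i j => hvD _ _
    choose D₁ hD₁D' hD₁ hxD₁ Λ hΛ using hminor
    set T : Finset α := insert a₀ ((Finset.range (m + 1)).biUnion fun k =>
      (Λ k).biUnion fun s => Finset.univ.image s.1) with hT
    set D₂ : Set E' := D' ∩ ⋂ k : Fin (m + 1), D₁ k with hD₂
    refine ⟨e '' (D₂ ×ˢ ball t₀ r), ?_, e.toHomeomorph.isOpenMap _
      ((hD'.inter (isOpen_iInter_of_finite fun k => hD₁ _)).prod isOpen_ball),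
      ⟨(x₀, t₀), ⟨⟨hxD', mem_iInter.2 fun k => hxD₁ _⟩, mem_ball_self hr⟩, heq⟩, T, ?_⟩
    · rintro _ ⟨⟨x, t⟩, ⟨hx, ht⟩, rfl⟩
      exact hBR x (hD'B hx.1) t (ball_subset_ball hrR.le ht)
    rintro _ ⟨⟨x, t⟩, ⟨hx, ht⟩, rfl⟩ hzero a
    have htA : t ∈ A x := (hA x hx.1 t).2 ⟨ht, hzero a₀ (Finset.mem_insert_self _ _)⟩
    obtain ⟨L, κ, hκ, hL⟩ := exists_linear_eval_of_moments (hcard x hx.1) htA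
    have hspan := mem_span_of_minors (v := v x) (Λ := (T : Set α)) (fun k hk h s c => by
      refine hΛ k x (mem_iInter.1 hx.2 ⟨k, Nat.lt_succ_of_le hk⟩) (fun s' hs' => ?_) (s, c)
      refine h s'.1 s'.2 fun i => ?_
      simp only [hT, Finset.mem_coe, Finset.mem_insert, Finset.mem_biUnion, Finset.mem_range,
        Finset.mem_image]
      exact Or.inr ⟨k, Nat.lt_succ_of_le hk, s', hs', i, Finset.mem_univ _, rfl⟩) a
    have hker : Submodule.span ℂ (v x '' T) ≤ LinearMap.ker L := by
      rw [Submodule.span_le]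
      rintro _ ⟨b, hb, rfl⟩
      rw [SetLike.mem_coe, LinearMap.mem_ker]
      exact (hL fun t => f b (e (x, t))).trans (by rw [hzero b hb, mul_zero])
    have := (hL fun t => f a (e (x, t))).symm.trans (LinearMap.mem_ker.1 (hker hspan))
    exact (mul_eq_zero.1 this).resolve_left hκ
  · have hev : ∀ᶠ x in 𝓝 q, f a₀ x ≠ 0 :=
      ((hf a₀).continuousOn.continuousAt (hD.mem_nhds hq)).eventually_ne hF0
    obtain ⟨δ, hδ, hδF⟩ := Metric.mem_nhds_iff.1 (inter_mem hev (hD.mem_nhds hq))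
    exact ⟨ball q δ, fun x hx => (hδF hx).2, isOpen_ball, mem_ball_self hδ, {a₀}, fun x hx h =>
      absurd (h a₀ (Finset.mem_singleton_self _)) (hδF hx).1⟩

theorem eq_zero_of_real_zeros {a r : ℝ} {h : ℂ → ℂ} (hh : DifferentiableOn ℂ h (ball (a : ℂ) r))
    (h0 : ∀ x : ℝ, (x : ℂ) ∈ ball (a : ℂ) r → h x = 0) : ∀ z ∈ ball (a : ℂ) r, h z = 0 := by
  intro z hz
  have hr : 0 < r := dist_nonneg.trans_lt (mem_ball.1 hz)
  have ht : Tendsto (fun x : ℝ => (x : ℂ)) (𝓝[≠] a) (𝓝[≠] (a : ℂ)) :=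
    tendsto_nhdsWithin_of_tendsto_nhds_of_eventually_within _
      ((continuous_ofReal.tendsto a).mono_left nhdsWithin_le_nhds)
      (eventually_nhdsWithin_of_forall fun x hx => by simpa using hx)
  have hev : ∀ᶠ x : ℝ in 𝓝[≠] a, h x = 0 :=
    ((continuous_ofReal.tendsto a).mono_left nhdsWithin_le_nhds
      |>.eventually (ball_mem_nhds (a : ℂ) hr)).mono fun x hx => h0 x hx
  exact (hh.analyticOnNhd isOpen_ball).eqOn_zero_of_preconnected_of_frequently_eq_zero
    (convex_ball _ _).isPreconnected (mem_ball_self hr) (ht.frequently hev.frequently) hz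

/-- A holomorphic function of `(s, t)` that vanishes for `t = conj s` vanishes. -/
theorem eq_zero_of_antidiagonal_zeros {Q : Set ℂ} (hQ : IsOpen Q) (hQc : Convex ℝ Q)
    {g : ℂ × ℂ → ℂ} (hg : DifferentiableOn ℂ g (Q ×ˢ (starRingEnd ℂ ⁻¹' Q)))
    (h0 : ∀ s ∈ Q, g (s, starRingEnd ℂ s) = 0) :
    ∀ z ∈ Q ×ˢ (starRingEnd ℂ ⁻¹' Q), g z = 0 := by
  intro z hz
  set s := z.1
  have hs : s ∈ Q := hz.1
  have hW : IsOpen (Q ×ˢ (starRingEnd ℂ ⁻¹' Q)) := hQ.prod (hQ.preimage continuous_conj)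
  have hWc : Convex ℝ (Q ×ˢ (starRingEnd ℂ ⁻¹' Q)) :=
    hQc.prod (hQc.linear_preimage Complex.conjLIE.toLinearEquiv.toLinearMap)
  obtain ⟨ε, hε, hεQ⟩ := Metric.isOpen_iff.1 hQ s hs
  set r := ε / 2 with hr
  have hr0 : 0 < r := half_pos hε
  have hmaps : ∀ a ∈ ball (s.re : ℂ) r, ∀ b ∈ ball (s.im : ℂ) r,
      (a + I * b, a - I * b) ∈ Q ×ˢ (starRingEnd ℂ ⁻¹' Q) := by
    intro a ha b hb
    rw [mem_ball_iff_norm] at ha hb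
    have key : ∀ a b : ℂ, ‖a - s.re‖ < r → ‖b - s.im‖ < r → a + I * b ∈ Q := by
      intro a b ha hb
      refine hεQ (mem_ball_iff_norm.2 ?_)
      have : a + I * b - s = (a - s.re) + I * (b - s.im) := by
        conv_lhs => rw [← Complex.re_add_im s]
        ring
      rw [this]
      refine (norm_add_le _ _).trans_lt ?_
      rw [norm_mul, norm_I, one_mul]
      linarith
    refine ⟨key a b ha hb, ?_⟩
    have hconj : starRingEnd ℂ (a - I * b) = starRingEnd ℂ a + I * starRingEnd ℂ b := by
      simp
    rw [mem_preimage, hconj]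
    refine key _ _ ?_ ?_
    · rw [← Complex.norm_conj]
      simpa using ha
    · rw [← Complex.norm_conj]
      simpa using hb
  have hG : ∀ a ∈ ball (s.re : ℂ) r, ∀ b ∈ ball (s.im : ℂ) r, g (a + I * b, a - I * b) = 0 := by
    intro a ha
    refine eq_zero_of_real_zeros (h := fun b => g (a + I * b, a - I * b))
      (hg.comp (f := fun b => (a + I * b, a - I * b)) (by fun_prop) fun b hb => hmaps a ha b hb) ?_
    intro y hy
    revert a ha
    refine eq_zero_of_real_zeros (h := fun a => g (a + I * y, a - I * y))
      (hg.comp (f := fun a => (a + I * y, a - I * y)) (by fun_prop)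
        fun a ha => hmaps a ha y hy) ?_
    intro x hx
    convert h0 (x + I * y) (hmaps x hx y hy).1 using 3
    simp [sub_eq_add_neg]
  refine eqOn_zero_of_eventually_zero hW hWc hg (q := (s, starRingEnd ℂ s)) ⟨hs, by simpa⟩ ?_ z hz
  have hta : Tendsto (fun z : ℂ × ℂ => (z.1 + z.2) / 2) (𝓝 (s, starRingEnd ℂ s))
      (𝓝 (s.re : ℂ)) := by
    refine Continuous.tendsto' (by fun_prop) _ _ ?_
    rw [Complex.add_conj]
    simp
  have htb : Tendsto (fun z : ℂ × ℂ => (z.1 - z.2) / (2 * I)) (𝓝 (s, starRingEnd ℂ s))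
      (𝓝 (s.im : ℂ)) := by
    refine Continuous.tendsto' (by fun_prop) _ _ ?_
    rw [Complex.sub_conj]
    field_simp
    simp
  filter_upwards [hta (ball_mem_nhds _ hr0), htb (ball_mem_nhds _ hr0)] with w ha hb
  have := hG _ ha _ hb
  convert this using 2
  ext
  all_goals
    simp only []
    field_simp
    ring

theorem conjPt_conjPt {N : ℕ} (z : CN N) : conjPt N (conjPt N z) = z := by
  funext i
  simp [conjPt]

theorem continuous_conjPt (N : ℕ) : Continuous (conjPt N) :=
  continuous_pi fun i => continuous_conj.comp (continuous_apply i)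

theorem DifferentiableOn.conjPt_conj {N : ℕ} {φ : ℂ → CN N} {Q : Set ℂ} (hQ : IsOpen Q)
    (hφ : DifferentiableOn ℂ φ Q) :
    DifferentiableOn ℂ (fun t => conjPt N (φ (starRingEnd ℂ t))) (starRingEnd ℂ ⁻¹' Q) := by
  intro t ht
  have := (hφ.differentiableAt (hQ.mem_nhds ht)).star_conj
  rw [Complex.conj_conj] at this
  exact this.differentiableWithinAt

/-- A function holomorphic in `(z, w)` that vanishes for `w = conj z`, `z` in a disc-connected set
`M`, vanishes for all `z` and `conj w` with `z, w ∈ M`. -/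
theorem IsDiscConnected.polarization {N : ℕ} {M U : Set (CN N)} (hM : IsDiscConnected M)
    (hMU : M ⊆ U) {R : CN N × CN N → ℂ}
    (hR : DifferentiableOn ℂ R (U ×ˢ (conjPt N ⁻¹' U)))
    (h0 : ∀ z ∈ M, R (z, conjPt N z) = 0) : ∀ z ∈ M, ∀ w ∈ M, R (z, conjPt N w) = 0 := by
  have hloc : ∀ x ∈ M, ∃ V ∈ 𝓝 x, ∀ y ∈ M ∩ V, ∀ y' ∈ M ∩ V, R (y, conjPt N y') = 0 := by
    intro x hx
    obtain ⟨V, hV, hVd⟩ := hM.2 x hx univ univ_mem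
    refine ⟨V, hV, fun y hy y' hy' => ?_⟩
    obtain ⟨φ, Q, hQ, hQc, hQ0, hQ1, hφ, hφM, rfl, rfl⟩ := hVd y hy y' hy'
    rw [inter_univ] at hφM
    have := eq_zero_of_antidiagonal_zeros hQ hQc
      (g := fun z => R (φ z.1, conjPt N (φ (starRingEnd ℂ z.2))))
      (hR.comp (f := fun z : ℂ × ℂ => (φ z.1, conjPt N (φ (starRingEnd ℂ z.2))))
        ((hφ.comp differentiableOn_fst fun z hz => hz.1).prodMk
          ((hφ.conjPt_conj hQ).comp differentiableOn_snd fun z hz => hz.2))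
        fun z hz => ⟨hMU (hφM hz.1), by
          rw [mem_preimage, conjPt_conjPt]
          exact hMU (hφM hz.2)⟩)
      (fun s hs => by
        simp only [Complex.conj_conj]
        exact h0 _ (hφM hs)) (0, 1) ⟨hQ0, by simpa⟩
    simpa using this
  intro z hz w hw
  have hdiff : DifferentiableOn ℂ (fun y => R (y, conjPt N w)) U :=
    hR.comp (f := fun y => (y, conjPt N w)) (by fun_prop) fun y hy =>
      ⟨hy, by
        rw [mem_preimage, conjPt_conjPt]
        exact hMU hw⟩
  have hprop : ∀ x ∈ M, ∃ V ∈ 𝓝 x, ∀ y ∈ M ∩ V, (∀ᶠ y' in 𝓝[M] y, R (y', conjPt N w) = 0) →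
      ∀ y' ∈ M ∩ V, R (y', conjPt N w) = 0 := by
    intro x hx
    obtain ⟨V, hV, hVd⟩ := hM.2 x hx univ univ_mem
    refine ⟨V, hV, fun y hy hy0 y' hy' => ?_⟩
    obtain ⟨φ, Q, hQ, hQc, hQ0, hQ1, hφ, hφM, rfl, rfl⟩ := hVd y hy y' hy'
    rw [inter_univ] at hφM
    have han : AnalyticOnNhd ℂ (fun s => R (φ s, conjPt N w)) Q :=
      (hdiff.comp hφ (hφM.mono_right hMU)).analyticOnNhd hQ
    have ht : Tendsto φ (𝓝 0) (𝓝[M] (φ 0)) :=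
      tendsto_nhdsWithin_iff.2 ⟨hφ.continuousOn.continuousAt (hQ.mem_nhds hQ0),
        mem_of_superset (hQ.mem_nhds hQ0) hφM⟩
    exact han.eqOn_zero_of_preconnected_of_eventuallyEq_zero hQc.isPreconnected hQ0
      (ht.eventually hy0) hQ1
  have hw0 : ∀ᶠ y in 𝓝[M] w, R (y, conjPt N w) = 0 := by
    obtain ⟨V, hV, hV0⟩ := hloc w hw
    filter_upwards [inter_mem_nhdsWithin M hV] with y hy
    exact hV0 y hy w ⟨hw, mem_of_mem_nhds hV⟩
  have hz0 : ∀ᶠ y in 𝓝[M] z, R (y, conjPt N w) = 0 := by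
    refine hM.1.induction₂' (fun x y => (∀ᶠ y' in 𝓝[M] x, R (y', conjPt N w) = 0) →
      ∀ᶠ y' in 𝓝[M] y, R (y', conjPt N w) = 0) (fun x hx => ?_)
      (fun _ _ _ _ _ _ h₁ h₂ h => h₂ (h₁ h)) hw hz hw0
    obtain ⟨V, hV, hV0⟩ := hprop x hx
    filter_upwards [inter_mem_nhdsWithin M (interior_mem_nhds.2 hV)] with y hy
    have hyV := interior_subset hy.2
    exact ⟨fun h => mem_of_superset (inter_mem_nhdsWithin M (mem_interior_iff_mem_nhds.1 hy.2))
        (hV0 x ⟨hx, mem_of_mem_nhds hV⟩ h),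
      fun h => mem_of_superset (inter_mem_nhdsWithin M hV) (hV0 y ⟨hy.1, hyV⟩ h)⟩
  exact hz0.self_of_nhdsWithin hz

/-- A real-analytic function is the pullback of a holomorphic function under a map `κ` whose
components along complex coordinates `ℓ j` are the real coordinates `c j`. -/
theorem AnalyticAt.exists_complexification {E G ι : Type*} [NormedAddCommGroup E]
    [NormedSpace ℝ E] [NormedAddCommGroup G] [NormedSpace ℂ G] [Fintype ι] {e : ι → E}
    {c : ι → E → ℝ} {ℓ : ι → G →L[ℂ] ℂ} {κ : E → G} (hc : ∀ u, u = ∑ j, c j u • e j)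
    (hℓ : ∀ j u, ℓ j (κ u) = c j u) (hκ : Tendsto κ (𝓝 0) (𝓝 0)) {f : E → ℝ} {x : E}
    (hf : AnalyticAt ℝ f x) :
    ∃ g : G → ℂ, AnalyticAt ℂ g 0 ∧ (∀ᶠ u in 𝓝 0, g (κ u) = f (x + u)) ∧
      ∀ y y', (∀ j, ℓ j y' = starRingEnd ℂ (ℓ j y)) → g y' = starRingEnd ℂ (g y) := by
  classical
  obtain ⟨p, r, hp⟩ := hf
  set P : FormalMultilinearSeries ℂ G ℂ := fun n => ∑ J : Fin n → ι,
    (p n (fun i => e (J i)) : ℂ) •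
      (ContinuousMultilinearMap.mkPiAlgebra ℂ (Fin n) ℂ).compContinuousLinearMap
        (fun i => ℓ (J i)) with hP
  set K : ℝ := ∑ j, ‖e j‖ * ‖ℓ j‖ with hK
  have hK0 : 0 ≤ K := Finset.sum_nonneg fun j _ => by positivity
  have hnorm : ∀ n, ‖P n‖ ≤ ‖p n‖ * K ^ n := by
    intro n
    rw [hK, Fintype.sum_pow, Finset.mul_sum]
    refine norm_sum_le_of_le _ fun J _ => ?_
    rw [norm_smul, Finset.prod_mul_distrib, ← mul_assoc]
    refine mul_le_mul ?_ ?_ (norm_nonneg _) (by positivity)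
    · rw [Complex.norm_real]
      exact (p n).le_opNorm _
    · refine (ContinuousMultilinearMap.norm_compContinuousLinearMap_le _ _).trans ?_
      rw [ContinuousMultilinearMap.norm_mkPiAlgebra, one_mul]
  have hradius : 0 < P.radius := by
    obtain ⟨s, hs0, hsr⟩ := ENNReal.lt_iff_exists_nnreal_btwn.1 (hp.r_pos.trans_le hp.r_le)
    obtain ⟨C, hC, hpC⟩ := p.norm_mul_pow_le_of_lt_radius hsr
    have hs : 0 < (s : ℝ) := by exact_mod_cast hs0
    have hs' : 0 < (s : ℝ) / (K + 1) := by positivity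
    refine lt_of_lt_of_le ?_ (P.le_radius_of_bound (r := Real.toNNReal (s / (K + 1))) C fun n => ?_)
    · rw [ENNReal.coe_pos]
      exact Real.toNNReal_pos.2 hs'
    · rw [Real.coe_toNNReal _ hs'.le]
      calc ‖P n‖ * ((s : ℝ) / (K + 1)) ^ n ≤ ‖p n‖ * K ^ n * ((s : ℝ) / (K + 1)) ^ n := by
            gcongr
            exact hnorm n
        _ = ‖p n‖ * (K / (K + 1) * s) ^ n := by
            rw [mul_assoc, ← mul_pow]
            congr 2
            ring
        _ ≤ ‖p n‖ * s ^ n := by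
            gcongr
            exact mul_le_of_le_one_left hs.le (div_le_one_of_le₀ (by linarith) (by linarith))
        _ ≤ C := hpC n
  have hval : ∀ n u, P n (fun _ => κ u) = (p n (fun _ => u) : ℂ) := by
    intro n u
    conv_rhs => rw [hc u, ContinuousMultilinearMap.map_sum]
    simp only [hP, sum_apply, smul_apply,
      ContinuousMultilinearMap.compContinuousLinearMap_apply,
      ContinuousMultilinearMap.mkPiAlgebra_apply, hℓ, ContinuousMultilinearMap.map_smul_univ,
      smul_eq_mul, Complex.ofReal_sum, Complex.ofReal_mul, Complex.ofReal_prod]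
    exact Finset.sum_congr rfl fun J _ => mul_comm _ _
  have hPball := P.hasFPowerSeriesOnBall hradius
  refine ⟨P.sum, hPball.analyticAt, ?_, fun y y' hy => ?_⟩
  swap
  · rw [FormalMultilinearSeries.sum, FormalMultilinearSeries.sum, Complex.conj_tsum]
    refine tsum_congr fun n => ?_
    simp only [hP, sum_apply, smul_apply, ContinuousMultilinearMap.compContinuousLinearMap_apply,
      ContinuousMultilinearMap.mkPiAlgebra_apply, hy, smul_eq_mul, map_sum, map_mul, map_prod,
      Complex.conj_ofReal]
  filter_upwards [hp.eventually_hasSum, hκ.eventually hPball.eventually_hasSum] with u h₁ h₂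
  simp only [hval, zero_add] at h₂
  exact h₂.unique (Complex.hasSum_ofReal.2 h₁)

/-- A real-analytic function has a Hermitian complexification. -/
theorem exists_complexification_conjPt {N : ℕ} {f : CN N → ℝ} {p : CN N}
    (hf : AnalyticAt ℝ f p) :
    ∃ R : CN N × CN N → ℂ, AnalyticAt ℂ R (p, conjPt N p) ∧
      (∀ᶠ z in 𝓝 p, R (z, conjPt N z) = f z) ∧
      ∀ z w, R (w, conjPt N z) = starRingEnd ℂ (R (z, conjPt N w)) := by
  classical
  set e : Fin N ⊕ Fin N → CN N := Sum.elim (fun i => Pi.single i 1) (fun i => Pi.single i I)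
  set c : Fin N ⊕ Fin N → CN N → ℝ := Sum.elim (fun i u => (u i).re) (fun i u => (u i).im)
  set π₁ : Fin N → CN N × CN N →L[ℂ] ℂ := fun i =>
    (ContinuousLinearMap.proj i).comp (ContinuousLinearMap.fst ℂ (CN N) (CN N))
  set π₂ : Fin N → CN N × CN N →L[ℂ] ℂ := fun i =>
    (ContinuousLinearMap.proj i).comp (ContinuousLinearMap.snd ℂ (CN N) (CN N))
  set ℓ : Fin N ⊕ Fin N → CN N × CN N →L[ℂ] ℂ := Sum.elim
    (fun i => (1 / 2 : ℂ) • (π₁ i + π₂ i)) (fun i => (1 / (2 * I) : ℂ) • (π₁ i - π₂ i))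
  obtain ⟨g, hg, hgf, hgσ⟩ := hf.exists_complexification (e := e) (c := c) (ℓ := ℓ)
    (κ := fun u => (u, conjPt N u))
    (fun u => by
      funext k
      simp only [Fintype.sum_sum_type, Finset.sum_apply, Pi.smul_apply]
      rw [Finset.sum_eq_single k, Finset.sum_eq_single k]
      · simp [e, c, Complex.re_add_im]
      · intro b _ hb
        simp [e, c, hb.symm]
      · simp
      · intro b _ hb
        simp [e, c, hb.symm]
      · simp)
    (by
      rintro (i | i) u
      · have h := Complex.add_conj (u i)
        simp only [one_div, ContinuousLinearMap.comp_apply, ContinuousLinearMap.coe_fst', conjPt,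
          ContinuousLinearMap.coe_snd', ContinuousLinearMap.proj_apply, Sum.elim_inl, smul_apply,
          add_apply, smul_eq_mul, ℓ, π₁, π₂, c, h]
        simp
      · simp only [ℓ, c, π₁, π₂, conjPt, Sum.elim_inr, smul_apply,
          sub_apply, ContinuousLinearMap.comp_apply,
          ContinuousLinearMap.coe_fst', ContinuousLinearMap.coe_snd',
          ContinuousLinearMap.proj_apply, Complex.sub_conj, smul_eq_mul]
        field_simp
        simp)
    ((continuous_id.prodMk (continuous_conjPt N)).tendsto' _ _ (by
      ext <;> simp [conjPt]))
  refine ⟨fun z => g (z - (p, conjPt N p)), ?_, ?_, fun z w => hgσ _ _ ?_⟩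
  · refine AnalyticAt.fun_comp (g := g) (f := fun z => z - (p, conjPt N p)) ?_
      (analyticAt_id.sub analyticAt_const)
    simpa using hg
  · have ht : Tendsto (fun z : CN N => z - p) (𝓝 p) (𝓝 0) :=
      Continuous.tendsto' (by fun_prop) _ _ (sub_self p)
    filter_upwards [ht.eventually hgf] with z hz
    rw [add_sub_cancel] at hz
    rw [← hz]
    congr 1
    ext <;> simp [conjPt]
  · rintro (i | i)
    · simp only [ℓ, π₁, π₂, conjPt, Sum.elim_inl, smul_apply, add_apply,
        ContinuousLinearMap.comp_apply, ContinuousLinearMap.coe_fst',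
        ContinuousLinearMap.coe_snd', ContinuousLinearMap.proj_apply, smul_eq_mul, map_mul,
        map_add, map_sub, map_div₀, map_one, map_ofNat, Complex.conj_conj]
      ring
    · simp only [ℓ, π₁, π₂, conjPt, Sum.elim_inr, smul_apply, sub_apply,
        ContinuousLinearMap.comp_apply, ContinuousLinearMap.coe_fst',
        ContinuousLinearMap.coe_snd', ContinuousLinearMap.proj_apply, smul_eq_mul, map_mul,
        map_sub, map_div₀, map_one, map_ofNat, Complex.conj_conj, Complex.conj_I]
      field_simp
      ring

theorem IsComplexSubvariety.of_local {N : ℕ} {U X : Set (CN N)} (hXU : X ⊆ U)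
    (h : ∀ p ∈ U, ∃ V : Set (CN N), IsOpen V ∧ p ∈ V ∧ V ⊆ U ∧
      ∃ (ι : Type) (_ : Finite ι) (f : ι → CN N → ℂ),
        (∀ i, AnalyticOn ℂ (f i) V) ∧ X ∩ V = {z ∈ V | ∀ i, f i z = 0}) :
    IsComplexSubvariety N U X := by
  refine ⟨hXU, ?_, fun p hp => ?_⟩
  · rintro z ⟨hzX, hzU⟩
    obtain ⟨V, hV, hzV, -, ι, -, f, hf, hfX⟩ := h z hzU
    refine (hfX.superset ⟨hzV, fun i => ?_⟩).1
    by_contra hne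
    have hnhds := ((hf i).continuousOn.continuousAt (hV.mem_nhds hzV)).eventually_ne hne
    obtain ⟨x, ⟨hxi, hxV⟩, hxX⟩ :=
      mem_closure_iff_nhds.1 hzX _ (inter_mem hnhds (hV.mem_nhds hzV))
    exact hxi ((hfX.subset ⟨hxX, hxV⟩).2 i)
  · obtain ⟨V, hV, hpV, hVU, ι, hι, f, hf, hfX⟩ := h p hp
    obtain ⟨k, ⟨e⟩⟩ := Finite.exists_equiv_fin ι
    refine ⟨V, hV, hpV, hVU, k, fun i => f (e.symm i), fun i => hf _, hfX.trans ?_⟩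
    ext z
    simp [e.symm.forall_congr_left]

theorem IsComplexSubvariety.union {N : ℕ} {U X Y : Set (CN N)} (hX : IsComplexSubvariety N U X)
    (hY : IsComplexSubvariety N U Y) : IsComplexSubvariety N U (X ∪ Y) := by
  refine .of_local (union_subset hX.1 hY.1) fun p hp => ?_
  obtain ⟨V, hV, hpV, hVU, k, f, hf, hfX⟩ := hX.2.2 p hp
  obtain ⟨V', hV', hpV', -, l, g, hg, hgY⟩ := hY.2.2 p hp
  refine ⟨V ∩ V', hV.inter hV', ⟨hpV, hpV'⟩, inter_subset_left.trans hVU, Fin k × Fin l,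
    inferInstance, fun i z => f i.1 z * g i.2 z,
    fun i => ((hf i.1).mono inter_subset_left).mul ((hg i.2).mono inter_subset_right), ?_⟩
  ext z
  constructor
  · rintro ⟨hz | hz, hzV⟩
    · exact ⟨hzV, fun i => mul_eq_zero_of_left ((hfX.subset ⟨hz, hzV.1⟩).2 i.1) _⟩
    · exact ⟨hzV, fun i => mul_eq_zero_of_right _ ((hgY.subset ⟨hz, hzV.2⟩).2 i.2)⟩
  · rintro ⟨hzV, hz⟩
    refine ⟨?_, hzV⟩
    by_contra hne
    rw [mem_union, not_or] at hne
    have h₁ : ∃ i, f i z ≠ 0 := by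
      by_contra! h
      exact hne.1 (hfX.superset ⟨hzV.1, h⟩).1
    have h₂ : ∃ i, g i z ≠ 0 := by
      by_contra! h
      exact hne.2 (hgY.superset ⟨hzV.2, h⟩).1
    obtain ⟨i, hi⟩ := h₁
    obtain ⟨j, hj⟩ := h₂
    exact mul_ne_zero hi hj (hz (i, j))

theorem IsComplexSubvariety.sUnion {N : ℕ} {U : Set (CN N)} (hU : IsOpen U)
    {𝓕 : Set (Set (CN N))} (h𝓕 : 𝓕.Finite) (h : ∀ X ∈ 𝓕, IsComplexSubvariety N U X) :
    IsComplexSubvariety N U (⋃₀ 𝓕) := by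
  induction 𝓕, h𝓕 using Set.Finite.induction_on with
  | empty =>
    rw [sUnion_empty]
    exact .of_local (empty_subset U) fun p hp => ⟨U, hU, hp, subset_rfl, Unit, inferInstance,
      fun _ _ => 1, fun _ => analyticOn_const, by simp⟩
  | insert _ _ ih =>
    rw [sUnion_insert]
    exact (h _ (mem_insert _ _)).union (ih fun X hX => h X (mem_insert_of_mem _ hX))

/-- The points of `U` polar to `A` with respect to all the complexified functions `R i`. -/
def polarIn {N : ℕ} {ι : Type} (U : Set (CN N)) (R : ι → CN N × CN N → ℂ) (A : Set (CN N)) :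
    Set (CN N) :=
  {z ∈ U | ∀ w ∈ A, ∀ i, R i (z, conjPt N w) = 0}

theorem isComplexSubvariety_polarIn {N : ℕ} {ι : Type} {U : Set (CN N)} (hU : IsOpen U)
    {R : ι → CN N × CN N → ℂ}
    (hR : ∀ i, AnalyticOnNhd ℂ (R i) (U ×ˢ (conjPt N ⁻¹' U))) {A : Set (CN N)} (hA : A ⊆ U) :
    IsComplexSubvariety N U (polarIn U R A) := by
  refine .of_local (fun z hz => hz.1) fun q hq => ?_
  have hf : ∀ a : A × ι, AnalyticOnNhd ℂ (fun z => R a.2 (z, conjPt N a.1)) U := by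
    intro a z hz
    refine (hR a.2 (z, conjPt N a.1) ⟨hz, ?_⟩).comp₂ analyticAt_id analyticAt_const
    rw [mem_preimage, conjPt_conjPt]
    exact hA a.1.2
  obtain ⟨D, hDU, hD, hqD, Λ, hΛ⟩ := exists_finset_common_zeros _ (CN N) rfl U q hU hq
    (fun a : A × ι => fun z => R a.2 (z, conjPt N a.1)) fun a => (hf a).contDiffOn hU.uniqueDiffOn
  refine ⟨D, hD, hqD, hDU, Λ, inferInstance, fun a z => R a.1.2 (z, conjPt N a.1.1),
    fun a => ((hf a).mono hDU).analyticOn, ?_⟩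
  ext z
  constructor
  · rintro ⟨hz, hzD⟩
    exact ⟨hzD, fun a => hz.2 _ a.1.1.2 _⟩
  · rintro ⟨hzD, hz⟩
    exact ⟨⟨hDU hzD, fun w hw i => hΛ z hzD (fun a ha => hz ⟨a, ha⟩) (⟨w, hw⟩, i)⟩, hzD⟩

theorem subset_polarIn_polarIn {N : ℕ} {ι : Type} {U : Set (CN N)} {R : ι → CN N × CN N → ℂ}
    (hR : ∀ i z w, R i (w, conjPt N z) = starRingEnd ℂ (R i (z, conjPt N w))) {A : Set (CN N)}
    (hA : A ⊆ U) : A ⊆ polarIn U R (polarIn U R A) := fun z hz =>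
  ⟨hA hz, fun w hw i => by rw [hR, hw.2 z hz i, map_zero]⟩

/-- Diederich–Fornaess: for a local real-analytic subvariety `S` and every
`p ∈ S`, there is a neighborhood `U` of `p` such that every germ of a complex variety at
a point `q ∈ U` contained in `S` extends to a closed complex subvariety of `U` contained
in `S ∩ U`. -/
theorem stmt7 (N : ℕ) (Ω S : Set (CN N)) (hΩ : IsOpen Ω)
    (hS : IsRealSubvariety N Ω S) :
    ∀ p ∈ S, ∃ U : Set (CN N), IsOpen U ∧ p ∈ U ∧ U ⊆ Ω ∧
      ∀ q ∈ U, ∀ V₀ V : Set (CN N), IsOpen V₀ → q ∈ V₀ →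
        IsComplexSubvariety N V₀ V → q ∈ V → V ⊆ S →
        ∃ W : Set (CN N), IsComplexSubvariety N U W ∧ W ⊆ S ∩ U ∧ q ∈ W ∧
          ∃ V' : Set (CN N), IsOpen V' ∧ q ∈ V' ∧ V ∩ V' ⊆ W := by
  intro p hp
  obtain ⟨V₁, hV₁, hpV₁, hV₁Ω, k, f, hf, hfS⟩ := hS.2.2 p (hS.1 hp)
  choose R hRan hRf hRσ using fun i => exists_complexification_conjPt
    (hV₁.analyticOn_iff_analyticOnNhd.1 (hf i) p hpV₁)
  have han : ∀ᶠ z in 𝓝 (p, conjPt N p), ∀ i, AnalyticAt ℂ (R i) z :=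
    eventually_all.2 fun i => (hRan i).eventually_analyticAt
  rw [nhds_prod_eq] at han
  obtain ⟨A, hA, B, hB, hAB⟩ := Filter.mem_prod_iff.1 han
  obtain ⟨U, hUsub, hU, hpU⟩ := _root_.mem_nhds_iff.1 (inter_mem (inter_mem hA
    ((continuous_conjPt N).continuousAt.preimage_mem_nhds hB))
    (inter_mem (hV₁.mem_nhds hpV₁) (eventually_all.2 hRf)))
  have hUV₁ : U ⊆ V₁ := fun z hz => (hUsub hz).2.1
  have hRU : ∀ i, AnalyticOnNhd ℂ (R i) (U ×ˢ (conjPt N ⁻¹' U)) := fun i z hz =>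
    hAB ⟨(hUsub hz.1).1.1, by simpa [conjPt_conjPt] using (hUsub hz.2).1.2⟩ i
  have hUS : ∀ z ∈ U, z ∈ S ↔ ∀ i, R i (z, conjPt N z) = 0 := by
    intro z hz
    have hfz : ∀ i, R i (z, conjPt N z) = f i z := (hUsub hz).2.2
    simp only [hfz, Complex.ofReal_eq_zero]
    exact ⟨fun h => (hfS.subset ⟨h, hUV₁ hz⟩).2, fun h => (hfS.superset ⟨hUV₁ hz, h⟩).1⟩
  refine ⟨U, hU, hpU, hUV₁.trans hV₁Ω, fun q hq V₀ V _ hqV₀ hV hqV hVS => ?_⟩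
  obtain ⟨V₂, hV₂, hqV₂, -, l, g, hg, hgV⟩ := hV.2.2 q hqV₀
  obtain ⟨D, hDsub, hD, hqD, 𝓜, h𝓜f, h𝓜D, h𝓜⟩ := exists_stratification _ (CN N) rfl (V₂ ∩ U) q
    (hV₂.inter hU) ⟨hqV₂, hq⟩ (Fin l) g fun i =>
      ((hg i).contDiffOn hV₂.uniqueDiffOn).mono inter_subset_left
  have hMD : ∀ M ∈ 𝓜, M ⊆ V₂ ∩ U := fun M hM =>
    (subset_sUnion_of_mem hM).trans (h𝓜D.subset.trans hDsub)
  set 𝓜₀ : Set (Set (CN N)) := {M ∈ 𝓜 | ∀ i, ∀ x ∈ M, g i x = 0}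
  have hsub : ∀ M ∈ 𝓜₀, M ⊆ polarIn U R M := by
    rintro M ⟨hM, hM0⟩ z hz
    refine ⟨(hMD M hM hz).2, fun w hw i => ?_⟩
    refine (h𝓜 M hM).1.polarization (fun x hx => (hMD M hM hx).2) (hRU i).differentiableOn
      (fun x hx => ?_) z hz w hw
    have hxV : x ∈ V := (hgV.superset ⟨(hMD M hM hx).1, fun i => hM0 i x hx⟩).1
    exact (hUS x (hMD M hM hx).2).1 (hVS hxV) i
  have hcover : V ∩ D ⊆ ⋃₀ ((fun M => polarIn U R (polarIn U R M)) '' 𝓜₀) := by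
    rintro z ⟨hzV, hzD⟩
    have hz0 := (hgV.subset ⟨hzV, (hDsub hzD).1⟩).2
    rw [← h𝓜D] at hzD
    obtain ⟨M, hM, hzM⟩ := hzD
    refine ⟨_, ⟨M, ⟨hM, fun i => ?_⟩, rfl⟩,
      subset_polarIn_polarIn hRσ (fun x hx => (hMD M hM hx).2) hzM⟩
    exact ((h𝓜 M hM).2 i).resolve_right fun h => h z hzM (hz0 i)
  refine ⟨⋃₀ ((fun M => polarIn U R (polarIn U R M)) '' 𝓜₀), ?_, ?_, hcover ⟨hqV, hqD⟩,
    D, hD, hqD, hcover⟩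
  · refine .sUnion hU ((h𝓜f.subset fun M hM => hM.1).image _) ?_
    rintro _ ⟨M, hM, rfl⟩
    exact isComplexSubvariety_polarIn hU hRU fun z hz => hz.1
  · rintro z ⟨_, ⟨M, hM, rfl⟩, hz⟩
    have hzM : z ∈ polarIn U R M := ⟨hz.1, fun w hw => hz.2 w (hsub M hM hw)⟩
    exact ⟨(hUS z hz.1).2 fun i => hz.2 z hzM i, hz.1⟩
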